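/- arXiv:1411.6733 — 7 statements merged into one kernel-verified Lean document; each statement's English description precedes it below -/
import Mathlib

section
/- Let G be a finite simple graph with n vertices and m edges, m ≥ 1, and let q_1, …, q_n be the (nonnegative real) eigenvalues of the signless Laplacian matrix Q(G). Then: (i) I^1 computed from q_1, …, q_n equals 1 − (M_1(G) + 2m)/(4m²); (ii) for every real α > 0 with α ≠ 1, I^2_α = (1/(1−α))·log(M*_α/(2m)^α); and (iii) I^3_α = (1/(2^{1−α} − 1))·(M*_α/(2m)^α − 1), where M*_α = Σ_{i=1}^n q_i^α. -/
open Polynomial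

/-- The degree of a vertex in a simple graph on `Fin n`. -/
noncomputable def deg {n : ℕ} (G : SimpleGraph (Fin n)) (i : Fin n) : ℕ :=
  letI := Classical.decRel G.Adj
  G.degree i

/-- The number of edges of a simple graph on `Fin n`. -/
noncomputable def numEdges {n : ℕ} (G : SimpleGraph (Fin n)) : ℕ :=
  letI := Classical.decRel G.Adj
  G.edgeFinset.card

/-- The signless Laplacian matrix `Q(G) = D(G) + A(G)`. -/
noncomputable def signlessLap {n : ℕ} (G : SimpleGraph (Fin n)) :
    Matrix (Fin n) (Fin n) ℝ :=
  letI := Classical.decRel G.Adj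
  Matrix.diagonal (fun i => (deg G i : ℝ)) + G.adjMatrix ℝ

/-- The first Zagreb index `M₁(G) = ∑ᵢ dᵢ²`. -/
noncomputable def zagreb1 {n : ℕ} (G : SimpleGraph (Fin n)) : ℝ :=
  ∑ i, (deg G i : ℝ) ^ 2

/-- The first generalized graph entropy `I¹ = 1 - (∑ |μᵢ|²)/(∑ |μⱼ|)²`. -/
noncomputable def I1 {n : ℕ} (μ : Fin n → ℝ) : ℝ :=
  1 - (∑ i, |μ i| ^ 2) / (∑ j, |μ j|) ^ 2

/-- The second generalized graph entropy (Rényi-type). -/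
noncomputable def I2 {n : ℕ} (α : ℝ) (μ : Fin n → ℝ) : ℝ :=
  (1 / (1 - α)) * Real.log (∑ i, (|μ i| / (∑ j, |μ j|)) ^ α)

/-- The third generalized graph entropy (Daròczy-type). -/
noncomputable def I3 {n : ℕ} (α : ℝ) (μ : Fin n → ℝ) : ℝ :=
  ((∑ i, (|μ i| / (∑ j, |μ j|)) ^ α) - 1) / ((2 : ℝ) ^ (1 - α) - 1)

theorem Matrix.IsHermitian.trace_pow_eq_sum_eigenvalues_pow {n : Type*} [Fintype n]
    [DecidableEq n] {A : Matrix n n ℝ} (hA : A.IsHermitian) (k : ℕ) :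
    (A ^ k).trace = ∑ i, hA.eigenvalues i ^ k := by
  conv_lhs => rw [hA.spectral_theorem, ← map_pow, Unitary.conjStarAlgAut_apply,
    Matrix.trace_mul_comm, ← mul_assoc]
  simp [Matrix.diagonal_pow, Matrix.trace_diagonal]

theorem Matrix.IsHermitian.trace_pow_eq_sum_pow_of_charpoly_eq {n ι : Type*} [Fintype n]
    [DecidableEq n] [Fintype ι] {A : Matrix n n ℝ} (hA : A.IsHermitian) {q : ι → ℝ}
    (hq : A.charpoly = ∏ i, (X - C (q i))) (k : ℕ) :
    (A ^ k).trace = ∑ i, q i ^ k := by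
  have hroots : Finset.univ.val.map hA.eigenvalues = Finset.univ.val.map q := by
    have h := hA.roots_charpoly_eq_eigenvalues
    rw [hq, Polynomial.roots_prod _ _
      (Finset.prod_ne_zero_iff.mpr fun i _ => X_sub_C_ne_zero (q i))] at h
    simpa [Multiset.bind_singleton] using h.symm
  rw [hA.trace_pow_eq_sum_eigenvalues_pow]
  have h := congrArg (fun s => (s.map (· ^ k)).sum) hroots
  simp only [Multiset.map_map] at h
  exact h

theorem signlessLap_isHermitian {n : ℕ} (G : SimpleGraph (Fin n)) :
    (signlessLap G).IsHermitian := by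
  classical
  unfold signlessLap
  refine (Matrix.isHermitian_diagonal _).add ?_
  rw [Matrix.IsHermitian, Matrix.conjTranspose_eq_transpose_of_trivial]
  exact G.isSymm_adjMatrix

theorem sum_deg {n : ℕ} (G : SimpleGraph (Fin n)) :
    ∑ i, (deg G i : ℝ) = 2 * numEdges G := by
  let _ := Classical.decRel G.Adj
  unfold deg numEdges
  exact_mod_cast G.sum_degrees_eq_twice_card_edges

theorem trace_signlessLap {n : ℕ} (G : SimpleGraph (Fin n)) :
    (signlessLap G).trace = 2 * numEdges G := by
  simp [signlessLap, sum_deg]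

theorem trace_signlessLap_sq {n : ℕ} (G : SimpleGraph (Fin n)) :
    (signlessLap G ^ 2).trace = zagreb1 G + 2 * numEdges G := by
  let _ := Classical.decRel G.Adj
  have hA : (G.adjMatrix ℝ * G.adjMatrix ℝ).trace = ∑ i, (deg G i : ℝ) := by
    simp only [Matrix.trace, Matrix.diag_apply, SimpleGraph.adjMatrix_mul_self_apply_self]
    rfl
  have hD : (Matrix.diagonal (fun i => (deg G i : ℝ)) * G.adjMatrix ℝ).trace = 0 := by
    simp only [Matrix.trace, Matrix.diag_apply, Matrix.diagonal_mul]
    simp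
  have hD' : (G.adjMatrix ℝ * Matrix.diagonal (fun i => (deg G i : ℝ))).trace = 0 := by
    rw [Matrix.trace_mul_comm, hD]
  unfold signlessLap
  rw [sq, add_mul, mul_add, mul_add, Matrix.trace_add, Matrix.trace_add, Matrix.trace_add,
    hA, hD, hD', sum_deg]
  simp [zagreb1, sq]

theorem sum_div_rpow {ι : Type*} (s : Finset ι) {q : ι → ℝ} (hq : ∀ i ∈ s, 0 ≤ q i)
    {c : ℝ} (hc : 0 ≤ c) (α : ℝ) :
    ∑ i ∈ s, (q i / c) ^ α = (∑ i ∈ s, q i ^ α) / c ^ α := by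
  rw [Finset.sum_div]
  exact Finset.sum_congr rfl fun i hi => Real.div_rpow (hq i hi) hc α

/-- Theorem 3.1: for the eigenvalues `q₁, …, qₙ` of the signless Laplacian of a
graph with `n` vertices and `m ≥ 1` edges,
`I¹ = 1 - (M₁ + 2m)/(4m²)`, and for `α > 0`, `α ≠ 1`,
`I²_α = (1/(1-α)) log (M*_α/(2m)^α)` and
`I³_α = (1/(2^{1-α}-1)) (M*_α/(2m)^α - 1)`, where `M*_α = ∑ qᵢ^α`. -/
theorem stmt0 {n m : ℕ} (G : SimpleGraph (Fin n)) (hm : 1 ≤ m)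
    (hedge : numEdges G = m)
    (q : Fin n → ℝ) (hq0 : ∀ i, 0 ≤ q i)
    (hq : (signlessLap G).charpoly = ∏ i, (X - C (q i))) :
    I1 q = 1 - (zagreb1 G + 2 * m) / (4 * (m : ℝ) ^ 2) ∧
    ∀ α : ℝ, 0 < α → α ≠ 1 →
      I2 α q = (1 / (1 - α)) * Real.log ((∑ i, q i ^ α) / (2 * (m : ℝ)) ^ α) ∧
      I3 α q = (1 / ((2 : ℝ) ^ (1 - α) - 1)) *
        ((∑ i, q i ^ α) / (2 * (m : ℝ)) ^ α - 1) := by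
  have hsum : ∑ i, q i = 2 * (m : ℝ) := by
    have h := (signlessLap_isHermitian G).trace_pow_eq_sum_pow_of_charpoly_eq hq 1
    simpa [trace_signlessLap, hedge] using h.symm
  have hsq : ∑ i, q i ^ 2 = zagreb1 G + 2 * m := by
    rw [← (signlessLap_isHermitian G).trace_pow_eq_sum_pow_of_charpoly_eq hq 2,
      trace_signlessLap_sq, hedge]
  have habs : ∀ i, |q i| = q i := fun i => abs_of_nonneg (hq0 i)
  refine ⟨?_, fun α _ _ => ?_⟩
  · simp only [I1, habs, hsum, hsq]
    ring
  · have hdiv := sum_div_rpow Finset.univ (fun i _ => hq0 i)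
      (by positivity : (0 : ℝ) ≤ 2 * m) α
    simp only [I2, I3, habs, hsum, hdiv]
    exact ⟨trivial, by ring⟩
end

section
/- Let G be a finite simple graph with n vertices, m edges and no isolated vertices, and let μ_1, …, μ_n and q_1, …, q_n be the (nonnegative real) eigenvalues of the normalized Laplacian matrix ℒ(G) and of the normalized signless Laplacian matrix 𝒬(G), respectively. Then: (i) I^1 computed from the eigenvalues of ℒ(G), and also I^1 computed from the eigenvalues of 𝒬(G), equals 1 − (n + 2·R_{−1}(G))/n²; (ii) for every real α > 0 with α ≠ 1, I^2_α computed from the eigenvalues of 𝒬(G) equals (1/(1−α))·log(M*_α/n^α); and (iii) I^3_α computed from the eigenvalues of 𝒬(G) equals (1/(2^{1−α} − 1))·(M*_α/n^α − 1), where M*_α = Σ_{i=1}^n q_i^α. -/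
open Polynomial

/-- The diagonal matrix `D(G)^{-1/2}`. -/
noncomputable def dInvSqrt {n : ℕ} (G : SimpleGraph (Fin n)) :
    Matrix (Fin n) (Fin n) ℝ :=
  Matrix.diagonal (fun i => 1 / Real.sqrt (deg G i))

/-- The normalized Laplacian matrix `ℒ(G) = D^{-1/2} (D - A) D^{-1/2}`. -/
noncomputable def normLap {n : ℕ} (G : SimpleGraph (Fin n)) :
    Matrix (Fin n) (Fin n) ℝ :=
  letI := Classical.decRel G.Adj
  dInvSqrt G * (Matrix.diagonal (fun i => (deg G i : ℝ)) - G.adjMatrix ℝ) * dInvSqrt G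

/-- The normalized signless Laplacian matrix `𝒬(G) = D^{-1/2} (D + A) D^{-1/2}`. -/
noncomputable def normSignlessLap {n : ℕ} (G : SimpleGraph (Fin n)) :
    Matrix (Fin n) (Fin n) ℝ :=
  letI := Classical.decRel G.Adj
  dInvSqrt G * (Matrix.diagonal (fun i => (deg G i : ℝ)) + G.adjMatrix ℝ) * dInvSqrt G

/-- The general Randić index with exponent `-1`,
`R₋₁(G) = ∑_{ij ∈ E(G)} 1/(dᵢ dⱼ)` (each edge counted once). -/
noncomputable def randicM1 {n : ℕ} (G : SimpleGraph (Fin n)) : ℝ :=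
  letI := Classical.decRel G.Adj
  (∑ i, ∑ j, if G.Adj i j then 1 / ((deg G i : ℝ) * (deg G j : ℝ)) else 0) / 2

/-- The trace of the square of a real symmetric matrix is the sum of its squared eigenvalues. -/
theorem Matrix.IsHermitian.trace_mul_self_eq_sum_sq_eigenvalues {ι : Type*} [Fintype ι]
    [DecidableEq ι] {A : Matrix ι ι ℝ} (hA : A.IsHermitian) :
    (A * A).trace = ∑ i, hA.eigenvalues i ^ 2 := by
  conv_lhs => rw [hA.spectral_theorem, ← map_mul, Unitary.conjStarAlgAut_apply,
    Matrix.trace_mul_comm, ← mul_assoc]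
  simp [Matrix.trace_diagonal, sq]

/-- The linear and quadratic power sums of the roots of the characteristic polynomial of a
real symmetric matrix are the traces of the matrix and of its square. -/
theorem Matrix.IsHermitian.power_sums_of_charpoly_eq {ι : Type*} [Fintype ι] [DecidableEq ι]
    {A : Matrix ι ι ℝ} (hA : A.IsHermitian) {μ : ι → ℝ}
    (hμ : A.charpoly = ∏ i, (X - C (μ i))) :
    ∑ i, μ i = A.trace ∧ ∑ i, μ i ^ 2 = (A * A).trace := by
  have hroots : Finset.univ.val.map hA.eigenvalues = Finset.univ.val.map μ := by
    have h := congrArg Polynomial.roots (hA.charpoly_eq.symm.trans hμ)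
    have hprod (f : ι → ℝ) : (∏ i, (X - C (f i))).roots = Finset.univ.val.map f := by
      rw [Polynomial.roots_prod _ _ (Finset.prod_ne_zero_iff.mpr fun i _ => X_sub_C_ne_zero _)]
      simp
    simpa only [RCLike.ofReal_real_eq_id, id, hprod] using h
  constructor
  · have h := congrArg Multiset.sum hroots
    simpa [hA.trace_eq_sum_eigenvalues] using h.symm
  · have h := congrArg (fun s => (s.map (· ^ 2)).sum) hroots
    simpa [hA.trace_mul_self_eq_sum_sq_eigenvalues, Multiset.map_map] using h.symm

/-- The common shape of the normalized Laplacian (`s = -1`) and signless Laplacian (`s = 1`). -/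
noncomputable def normSignedLap {n : ℕ} (G : SimpleGraph (Fin n)) (s : ℝ) :
    Matrix (Fin n) (Fin n) ℝ :=
  letI := Classical.decRel G.Adj
  dInvSqrt G * (Matrix.diagonal (fun i => (deg G i : ℝ)) + s • G.adjMatrix ℝ) * dInvSqrt G

theorem normLap_eq_normSignedLap {n : ℕ} (G : SimpleGraph (Fin n)) :
    normLap G = normSignedLap G (-1) := by
  simp [normLap, normSignedLap, sub_eq_add_neg]

theorem normSignlessLap_eq_normSignedLap {n : ℕ} (G : SimpleGraph (Fin n)) :
    normSignlessLap G = normSignedLap G 1 := by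
  simp [normSignlessLap, normSignedLap]

open Classical in
theorem normSignedLap_apply {n : ℕ} (G : SimpleGraph (Fin n)) (hiso : ∀ v, 0 < deg G v)
    (s : ℝ) (i j : Fin n) :
    normSignedLap G s i j = (if i = j then 1 else 0) +
      if G.Adj i j then s / (√(deg G i) * √(deg G j)) else 0 := by
  have hd (v : Fin n) : (0 : ℝ) < deg G v := Nat.cast_pos.mpr (hiso v)
  have hne := (Real.sqrt_pos.mpr (hd j)).ne'
  have hsq := Real.mul_self_sqrt (hd j).le
  simp only [normSignedLap, dInvSqrt, Matrix.mul_diagonal, Matrix.diagonal_mul, Matrix.add_apply,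
    Matrix.smul_apply, SimpleGraph.adjMatrix_apply, Matrix.diagonal_apply, smul_eq_mul]
  rcases eq_or_ne i j with rfl | hij
  · simp only [SimpleGraph.irrefl, if_true, if_false, mul_zero, add_zero]
    field_simp
    rw [sq, hsq]
  · by_cases h : G.Adj i j
    · simp [hij, h]
      ring
    · simp [hij, h]

theorem normSignedLap_isHermitian {n : ℕ} (G : SimpleGraph (Fin n))
    (hiso : ∀ v, 0 < deg G v) (s : ℝ) : (normSignedLap G s).IsHermitian := by
  classical
  ext i j
  simp [normSignedLap_apply G hiso, eq_comm, G.adj_comm, mul_comm]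

theorem trace_normSignedLap {n : ℕ} (G : SimpleGraph (Fin n))
    (hiso : ∀ v, 0 < deg G v) (s : ℝ) : (normSignedLap G s).trace = n := by
  simp [Matrix.trace, normSignedLap_apply G hiso]

theorem trace_normSignedLap_mul_self {n : ℕ} (G : SimpleGraph (Fin n))
    (hiso : ∀ v, 0 < deg G v) {s : ℝ} (hs : s ^ 2 = 1) :
    (normSignedLap G s * normSignedLap G s).trace = n + 2 * randicM1 G := by
  classical
  have hentry (i j : Fin n) : normSignedLap G s i j * normSignedLap G s j i =
      (if i = j then 1 else 0) +
        if G.Adj i j then 1 / ((deg G i : ℝ) * (deg G j : ℝ)) else 0 := by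
    have hsymm : normSignedLap G s j i = normSignedLap G s i j := by
      simpa using (normSignedLap_isHermitian G hiso s).apply i j
    rw [hsymm, normSignedLap_apply G hiso]
    rcases eq_or_ne i j with rfl | hij
    · simp
    · by_cases h : G.Adj i j
      · simp only [hij, h, if_true, if_false, zero_add]
        rw [← sq, div_pow, hs, mul_pow, Real.sq_sqrt (Nat.cast_nonneg _),
          Real.sq_sqrt (Nat.cast_nonneg _)]
      · simp [hij, h]
  simp only [Matrix.trace, Matrix.diag_apply, Matrix.mul_apply, hentry, Finset.sum_add_distrib,
    randicM1]
  rw [mul_div_cancel₀ _ (two_ne_zero' ℝ)]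
  congr 1
  simp

theorem power_sums_normSignedLap {n : ℕ} (G : SimpleGraph (Fin n))
    (hiso : ∀ v, 0 < deg G v) {s : ℝ} (hs : s ^ 2 = 1) {μ : Fin n → ℝ}
    (hμ : (normSignedLap G s).charpoly = ∏ i, (X - C (μ i))) :
    ∑ i, μ i = n ∧ ∑ i, μ i ^ 2 = n + 2 * randicM1 G := by
  simpa only [trace_normSignedLap G hiso, trace_normSignedLap_mul_self G hiso hs] using
    (normSignedLap_isHermitian G hiso s).power_sums_of_charpoly_eq hμ

theorem sum_abs_div_rpow {n : ℕ} {μ : Fin n → ℝ} (hμ : ∀ i, 0 ≤ μ i) (hsum : ∑ i, μ i = n)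
    (α : ℝ) : ∑ i, (|μ i| / ∑ j, |μ j|) ^ α = (∑ i, μ i ^ α) / (n : ℝ) ^ α := by
  simp only [abs_of_nonneg (hμ _), hsum, Finset.sum_div]
  exact Finset.sum_congr rfl fun i _ => Real.div_rpow (hμ i) n.cast_nonneg α

/-- Theorem 3.2: for a graph with no isolated vertices, with `μ` and `q` the
eigenvalues of the normalized Laplacian and normalized signless Laplacian,
`I¹` computed from either equals `1 - (n + 2R₋₁(G))/n²`, and for `α > 0`,
`α ≠ 1`, `I²_α = (1/(1-α)) log (M*_α/n^α)` and
`I³_α = (1/(2^{1-α}-1)) (M*_α/n^α - 1)`, where `M*_α = ∑ qᵢ^α`. -/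
theorem stmt1 {n : ℕ} (G : SimpleGraph (Fin n))
    (hiso : ∀ v, 0 < deg G v)
    (μ q : Fin n → ℝ) (hμ0 : ∀ i, 0 ≤ μ i) (hq0 : ∀ i, 0 ≤ q i)
    (hμ : (normLap G).charpoly = ∏ i, (X - C (μ i)))
    (hq : (normSignlessLap G).charpoly = ∏ i, (X - C (q i))) :
    I1 μ = 1 - ((n : ℝ) + 2 * randicM1 G) / (n : ℝ) ^ 2 ∧
    I1 q = 1 - ((n : ℝ) + 2 * randicM1 G) / (n : ℝ) ^ 2 ∧
    ∀ α : ℝ, 0 < α → α ≠ 1 →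
      I2 α q = (1 / (1 - α)) * Real.log ((∑ i, q i ^ α) / (n : ℝ) ^ α) ∧
      I3 α q = (1 / ((2 : ℝ) ^ (1 - α) - 1)) *
        ((∑ i, q i ^ α) / (n : ℝ) ^ α - 1) := by
  rw [normLap_eq_normSignedLap] at hμ
  rw [normSignlessLap_eq_normSignedLap] at hq
  obtain ⟨hμ1, hμ2⟩ := power_sums_normSignedLap G hiso (by norm_num) hμ
  obtain ⟨hq1, hq2⟩ := power_sums_normSignedLap G hiso (by norm_num) hq
  refine ⟨?_, ?_, fun α _ _ => ⟨?_, ?_⟩⟩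
  · simp only [I1, abs_of_nonneg (hμ0 _), hμ1, hμ2]
  · simp only [I1, abs_of_nonneg (hq0 _), hq1, hq2]
  · rw [I2, sum_abs_div_rpow hq0 hq1]
  · rw [I3, sum_abs_div_rpow hq0 hq1, one_div, inv_mul_eq_div]
end

section
/- Let G be a finite simple graph with n vertices and m edges, m ≥ 1. Then the generalized graph entropy of the signless Laplacian, I_Q^1(G) = 1 − (M_1(G) + 2m)/(4m²), satisfies I_Q^1(G) ≤ 1 − 1/(2m) − 1/n. -/
/-- The handshake lemma. -/
theorem sum_deg_eq_two_mul_numEdges {n : ℕ} (G : SimpleGraph (Fin n)) :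
    ∑ i, deg G i = 2 * numEdges G := by
  classical
  unfold deg numEdges
  convert G.sum_degrees_eq_twice_card_edges

theorem four_mul_numEdges_sq_le {n : ℕ} (G : SimpleGraph (Fin n)) :
    4 * (numEdges G : ℝ) ^ 2 ≤ n * zagreb1 G := by
  have hsum : ∑ i, (deg G i : ℝ) = 2 * numEdges G := by
    exact_mod_cast sum_deg_eq_two_mul_numEdges G
  have hcs := sq_sum_le_card_mul_sum_sq (s := Finset.univ) (f := fun i => (deg G i : ℝ))
  rw [hsum, Finset.card_univ, Fintype.card_fin] at hcs
  unfold zagreb1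
  linarith

/-- Corollary: for a graph with `n` vertices and `m ≥ 1` edges, the
generalized entropy of the signless Laplacian
`I¹_Q(G) = 1 - (M₁(G) + 2m)/(4m²)` satisfies
`I¹_Q(G) ≤ 1 - 1/(2m) - 1/n`. -/
theorem stmt9 {n m : ℕ} (G : SimpleGraph (Fin n)) (hm : 1 ≤ m)
    (hedge : numEdges G = m) :
    1 - (zagreb1 G + 2 * m) / (4 * (m : ℝ) ^ 2) ≤
      1 - 1 / (2 * (m : ℝ)) - 1 / (n : ℝ) := by
  have hm' : (0 : ℝ) < m := by exact_mod_cast hm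
  have hle := four_mul_numEdges_sq_le G
  rw [hedge] at hle
  have hn : (0 : ℝ) < n := by
    rcases n.eq_zero_or_pos with rfl | h
    · norm_num at hle
      nlinarith
    · exact_mod_cast h
  have hdiv : 1 / (n : ℝ) ≤ zagreb1 G / (4 * (m : ℝ) ^ 2) := by
    rw [div_le_div_iff₀ hn (by positivity)]
    linarith
  have hsplit : (2 * m : ℝ) / (4 * (m : ℝ) ^ 2) = 1 / (2 * m) := by
    field_simp
    norm_num
  rw [add_div, hsplit]
  linarith
end

section
/- Let G be a finite simple graph with n vertices and m edges, m ≥ 1, with minimum degree δ ≥ 1 and maximum degree Δ. Then the generalized graph entropy of the signless Laplacian satisfies I_Q^1(G) ≥ 1 − 1/(2m) − 1/(2n) − (Δ² + δ²)/(4nΔδ), with equality if and only if G is a regular graph, or G is a graph whose vertices have exactly the two degrees Δ and δ, where Δ + δ divides δn and there are exactly p = δn/(δ + Δ) vertices of degree Δ and q = Δn/(δ + Δ) vertices of degree δ. -/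
/-- The minimum degree of a simple graph on `Fin n`. -/
noncomputable def minDeg {n : ℕ} (G : SimpleGraph (Fin n)) : ℕ :=
  letI := Classical.decRel G.Adj
  G.minDegree

/-- The maximum degree of a simple graph on `Fin n`. -/
noncomputable def maxDeg {n : ℕ} (G : SimpleGraph (Fin n)) : ℕ :=
  letI := Classical.decRel G.Adj
  G.maxDegree

theorem minDeg_le_deg {n : ℕ} (G : SimpleGraph (Fin n)) (v : Fin n) : minDeg G ≤ deg G v := by
  classical
  exact G.minDegree_le_degree v

theorem deg_le_maxDeg {n : ℕ} (G : SimpleGraph (Fin n)) (v : Fin n) : deg G v ≤ maxDeg G := by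
  classical
  exact G.degree_le_maxDegree v

theorem exists_deg_eq_minDeg {n : ℕ} [NeZero n] (G : SimpleGraph (Fin n)) :
    ∃ v, deg G v = minDeg G := by
  let := Classical.decRel G.Adj
  obtain ⟨v, hv⟩ := G.exists_minimal_degree_vertex
  exact ⟨v, hv.symm⟩

theorem exists_deg_eq_maxDeg {n : ℕ} [NeZero n] (G : SimpleGraph (Fin n)) :
    ∃ v, deg G v = maxDeg G := by
  let := Classical.decRel G.Adj
  obtain ⟨v, hv⟩ := G.exists_maximal_degree_vertex
  exact ⟨v, hv.symm⟩

theorem sum_deg_eq {n : ℕ} (G : SimpleGraph (Fin n)) : ∑ v, deg G v = 2 * numEdges G := by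
  let := Classical.decRel G.Adj
  exact G.sum_degrees_eq_twice_card_edges

theorem numEdges_of_isEmpty {n : ℕ} [IsEmpty (Fin n)] (G : SimpleGraph (Fin n)) :
    numEdges G = 0 := by
  have h := sum_deg_eq G
  rw [Finset.univ_eq_empty, Finset.sum_empty] at h
  omega

/-- The Diaz–Metcalf defect of the degree sequence, in terms of the Zagreb index. -/
theorem sum_sub_mul_sub {n : ℕ} (G : SimpleGraph (Fin n)) (a b : ℝ) :
    ∑ v, (a - deg G v) * (deg G v - b) =
      2 * numEdges G * (a + b) - zagreb1 G - n * a * b := by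
  have h : (∑ v, (deg G v : ℝ)) = 2 * numEdges G := by exact_mod_cast sum_deg_eq G
  have e : ∀ v, (a - deg G v) * (deg G v - b) =
      (deg G v : ℝ) * (a + b) - (deg G v : ℝ) ^ 2 - a * b := fun v ↦ by ring
  simp only [e, Finset.sum_sub_distrib, ← Finset.sum_mul, h, zagreb1, Finset.sum_const,
    Finset.card_univ, Fintype.card_fin, nsmul_eq_mul]

theorem entropy_sub_bound_eq {m n a b M : ℝ} (hm : m ≠ 0) (hn : n ≠ 0) (ha : a ≠ 0)
    (hb : b ≠ 0) :
    1 - (M + 2 * m) / (4 * m ^ 2) -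
        (1 - 1 / (2 * m) - 1 / (2 * n) - (a ^ 2 + b ^ 2) / (4 * n * a * b)) =
      ((m * (a + b) - n * a * b) ^ 2 + n * a * b * (2 * m * (a + b) - M - n * a * b)) /
        (4 * m ^ 2 * (n * a * b)) := by
  field_simp
  ring

theorem maxDeg_sub_mul_sub_minDeg_nonneg {n : ℕ} (G : SimpleGraph (Fin n)) (v : Fin n) :
    0 ≤ ((maxDeg G : ℝ) - deg G v) * (deg G v - minDeg G) :=
  mul_nonneg (sub_nonneg.2 (by exact_mod_cast deg_le_maxDeg G v))
    (sub_nonneg.2 (by exact_mod_cast minDeg_le_deg G v))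

theorem sum_sub_mul_sub_eq_zero_iff {n : ℕ} (G : SimpleGraph (Fin n)) :
    ∑ v, ((maxDeg G : ℝ) - deg G v) * (deg G v - minDeg G) = 0 ↔
      ∀ v, deg G v = maxDeg G ∨ deg G v = minDeg G := by
  rw [Finset.sum_eq_zero_iff_of_nonneg fun v _ ↦ maxDeg_sub_mul_sub_minDeg_nonneg G v]
  simp only [Finset.mem_univ, forall_const, mul_eq_zero, sub_eq_zero, Nat.cast_inj]
  simp only [eq_comm (a := maxDeg G)]

theorem card_filter_add_card_filter {n a b : ℕ} {G : SimpleGraph (Fin n)} (hab : a ≠ b)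
    (h : ∀ v, deg G v = a ∨ deg G v = b) :
    (Finset.univ.filter (fun v => deg G v = a)).card +
      (Finset.univ.filter (fun v => deg G v = b)).card = n := by
  have e : (Finset.univ.filter (fun v => deg G v = b)) =
      Finset.univ.filter (fun v => ¬ deg G v = a) :=
    Finset.filter_congr fun v _ ↦ ⟨fun hv hv' ↦ hab (hv'.symm.trans hv), (h v).resolve_left⟩
  rw [e, Finset.card_filter_add_card_filter_not, Finset.card_univ, Fintype.card_fin]

theorem two_mul_numEdges_of_two_degrees {n a b : ℕ} {G : SimpleGraph (Fin n)} (hab : a ≠ b)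
    (h : ∀ v, deg G v = a ∨ deg G v = b) :
    2 * numEdges G = (Finset.univ.filter (fun v => deg G v = a)).card * a +
      (Finset.univ.filter (fun v => deg G v = b)).card * b := by
  have e (v) : deg G v = (if deg G v = a then a else 0) + (if deg G v = b then b else 0) := by
    rcases h v with hv | hv
    · simp [hv, hab]
    · simp [hv, hab.symm]
  rw [← sum_deg_eq, Finset.sum_congr rfl fun v _ ↦ e v, Finset.sum_add_distrib,
    ← Finset.sum_filter, ← Finset.sum_filter, Finset.sum_const, Finset.sum_const,
    smul_eq_mul, smul_eq_mul]

/-- For two distinct degrees, the balance condition `m(a + b) = nab` says that the vertices of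
degree `a` and those of degree `b` occur in the proportion `b : a`. -/
theorem balance_iff_card {m n a b p q : ℕ} (ha : 0 < a) (hab : a ≠ b)
    (hpq : p + q = n) (hm : 2 * m = p * a + q * b) :
    m * (a + b) = n * a * b ↔
      (a + b) ∣ b * n ∧ p = b * n / (b + a) ∧ q = a * n / (b + a) := by
  have hs : 0 < b + a := by omega
  have key : m * (a + b) = n * a * b ↔ p * a = q * b := by
    subst hpq
    have e : (2 : ℤ) * (m * (a + b) - (p + q) * a * b) = (a - b) * (p * a - q * b) := by
      have : (2 : ℤ) * m = p * a + q * b := by exact_mod_cast hm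
      linear_combination ((a : ℤ) + b) * this
    have hab' : (a : ℤ) - b ≠ 0 := sub_ne_zero.2 (by exact_mod_cast hab)
    zify
    rw [← sub_eq_zero, ← sub_eq_zero (a := (p * a : ℤ))]
    constructor <;> intro h
    · rw [h, mul_zero, eq_comm, mul_eq_zero] at e
      exact e.resolve_left hab'
    · rw [h, mul_zero] at e
      linarith
  rw [key]
  constructor
  · intro h
    have hp : b * n = (b + a) * p := by rw [← hpq]; linarith
    have hq : a * n = (b + a) * q := by rw [← hpq]; linarith
    exact ⟨⟨p, by rw [hp, add_comm]⟩, by rw [hp, Nat.mul_div_cancel_left _ hs],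
      by rw [hq, Nat.mul_div_cancel_left _ hs]⟩
  · rintro ⟨hd, hp, -⟩
    rw [add_comm] at hd
    have h : p * (b + a) = b * n := by rw [hp, Nat.div_mul_cancel hd]
    rw [← hpq] at h
    linarith


/-- Corollary: for a graph with `n` vertices, `m ≥ 1` edges, minimum degree
`δ ≥ 1` and maximum degree `Δ`, the generalized entropy of the signless
Laplacian `I¹_Q(G) = 1 - (M₁(G) + 2m)/(4m²)` satisfies
`I¹_Q(G) ≥ 1 - 1/(2m) - 1/(2n) - (Δ² + δ²)/(4nΔδ)`, with equality iff `G` is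
regular, or the vertices of `G` have exactly the two degrees `Δ` and `δ`,
`Δ + δ` divides `δn`, and there are exactly `δn/(δ+Δ)` vertices of degree `Δ`
and `Δn/(δ+Δ)` vertices of degree `δ`. -/
theorem stmt10 {n m δ Δ : ℕ} (G : SimpleGraph (Fin n)) (hm : 1 ≤ m)
    (hedge : numEdges G = m) (hδ : minDeg G = δ) (hΔ : maxDeg G = Δ)
    (hδ1 : 1 ≤ δ) :
    1 - (zagreb1 G + 2 * m) / (4 * (m : ℝ) ^ 2) ≥
      1 - 1 / (2 * (m : ℝ)) - 1 / (2 * (n : ℝ)) -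
        ((Δ : ℝ) ^ 2 + (δ : ℝ) ^ 2) / (4 * (n : ℝ) * (Δ : ℝ) * (δ : ℝ)) ∧
    (1 - (zagreb1 G + 2 * m) / (4 * (m : ℝ) ^ 2) =
      1 - 1 / (2 * (m : ℝ)) - 1 / (2 * (n : ℝ)) -
        ((Δ : ℝ) ^ 2 + (δ : ℝ) ^ 2) / (4 * (n : ℝ) * (Δ : ℝ) * (δ : ℝ)) ↔
      (∃ d, ∀ v, deg G v = d) ∨
      ((∀ v, deg G v = Δ ∨ deg G v = δ) ∧
        (∃ v, deg G v = Δ) ∧ (∃ v, deg G v = δ) ∧ Δ ≠ δ ∧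
        (Δ + δ) ∣ δ * n ∧
        (Finset.univ.filter (fun v => deg G v = Δ)).card = δ * n / (δ + Δ) ∧
        (Finset.univ.filter (fun v => deg G v = δ)).card = Δ * n / (δ + Δ))) := by
  have : NeZero n := ⟨by
    rintro rfl
    have := numEdges_of_isEmpty G
    omega⟩
  subst hδ hΔ hedge
  obtain ⟨u, hu⟩ := exists_deg_eq_maxDeg G
  obtain ⟨w, hw⟩ := exists_deg_eq_minDeg G
  have hle : minDeg G ≤ maxDeg G := hw ▸ deg_le_maxDeg G w
  have hm0 : (0 : ℝ) < numEdges G := by exact_mod_cast hm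
  have hn0 : (0 : ℝ) < n := by exact_mod_cast Nat.pos_of_neZero n
  have hδ0 : (0 : ℝ) < minDeg G := by exact_mod_cast hδ1
  have hΔ0 : (0 : ℝ) < maxDeg G := by exact_mod_cast hδ1.trans hle
  have hP : (0 : ℝ) < n * maxDeg G * minDeg G := by positivity
  have hK : 0 ≤ ∑ v, ((maxDeg G : ℝ) - deg G v) * (deg G v - minDeg G) :=
    Finset.sum_nonneg fun v _ ↦ maxDeg_sub_mul_sub_minDeg_nonneg G v
  have hE := entropy_sub_bound_eq (M := zagreb1 G) hm0.ne' hn0.ne' hΔ0.ne' hδ0.ne'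
  rw [← sum_sub_mul_sub] at hE
  constructor
  · rw [ge_iff_le, ← sub_nonneg, hE]
    positivity
  rw [← sub_eq_zero, hE, div_eq_zero_iff, or_iff_left (by positivity),
    add_eq_zero_iff_of_nonneg (sq_nonneg _) (mul_nonneg hP.le hK), sq_eq_zero_iff,
    mul_eq_zero_iff_left hP.ne', sum_sub_mul_sub_eq_zero_iff, sub_eq_zero]
  norm_cast
  by_cases hne : maxDeg G = minDeg G
  · have hreg (v) : deg G v = minDeg G :=
      le_antisymm (hne ▸ deg_le_maxDeg G v) (minDeg_le_deg G v)
    have hsum := sum_deg_eq G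
    simp only [hreg, Finset.sum_const, Finset.card_univ, Fintype.card_fin, smul_eq_mul] at hsum
    refine iff_of_true ⟨?_, fun v ↦ .inr (hreg v)⟩ (.inl ⟨_, hreg⟩)
    rw [hne, hsum]
    ring
  · rw [or_iff_right fun ⟨d, hd⟩ ↦ hne (by rw [← hu, ← hw, hd, hd]), and_comm]
    refine and_congr_right fun h ↦ ?_
    rw [balance_iff_card (hδ1.trans hle) hne (card_filter_add_card_filter hne h)
      (two_mul_numEdges_of_two_degrees hne h)]
    exact ⟨fun hc ↦ ⟨⟨u, hu⟩, ⟨w, hw⟩, hne, hc⟩, fun hc ↦ hc.2.2.2⟩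
end

section
/- Let G be a finite simple graph with n ≥ 2 vertices and no isolated vertices, and let I^1_{ℒ(𝒬)}(G) = 1 − (n + 2·R_{−1}(G))/n² be the generalized graph entropy of the normalized (signless) Laplacian. If n is odd, then 1 − 2/n + 1/n² ≤ I^1_{ℒ(𝒬)}(G) ≤ 1 − 1/(n−1); if n is even, then 1 − 2/n ≤ I^1_{ℒ(𝒬)}(G) ≤ 1 − 1/(n−1). The right equality holds if and only if G is a complete graph; the left equality holds if and only if G is the disjoint union of n/2 paths of length 1 when n is even, and the disjoint union of (n−3)/2 paths of length 1 and one path of length 2 when n is odd. -/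
/-- The generalized entropy of the normalized (signless) Laplacian,
`I¹_{ℒ(𝒬)}(G) = 1 - (n + 2R₋₁(G))/n²`. -/
noncomputable def entropyNormLap {n : ℕ} (G : SimpleGraph (Fin n)) : ℝ :=
  1 - ((n : ℝ) + 2 * randicM1 G) / (n : ℝ) ^ 2

/-- The disjoint union of `n/2` paths of length 1 (a perfect matching) on `n`
vertices (`n` even): vertices `2k` and `2k+1` are joined, for each `k`. -/
def evenMatching (n : ℕ) : SimpleGraph (Fin n) :=
  SimpleGraph.fromRel (fun i j => (i : ℕ) / 2 = (j : ℕ) / 2)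

/-- The disjoint union of one path of length 2 and `(n-3)/2` paths of length 1
on `n` vertices (`n` odd): vertices `0-1-2` form a path, and vertices `2k+3`
and `2k+4` are joined, for each `k`. -/
def oddMatching (n : ℕ) : SimpleGraph (Fin n) :=
  SimpleGraph.fromRel (fun i j =>
    ((i : ℕ) < 3 ∧ (j : ℕ) < 3 ∧ (j : ℕ) = (i : ℕ) + 1) ∨
    (3 ≤ (i : ℕ) ∧ 3 ≤ (j : ℕ) ∧ ((i : ℕ) - 3) / 2 = ((j : ℕ) - 3) / 2))

open Equiv Finset in
/-- Two involutions moving equally many points are conjugate. -/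
theorem Equiv.Perm.isConj_of_involutive {α : Type*} [Fintype α] [DecidableEq α] {σ τ : Perm α}
    (hσ : Function.Involutive σ) (hτ : Function.Involutive τ)
    (h : #σ.support = #τ.support) : IsConj σ τ := by
  have hsq {ρ : Perm α} (hρ : Function.Involutive ρ) : ρ ^ 2 = 1 := by
    ext x; simpa [sq] using hρ x
  have hct {ρ : Perm α} (hρ : Function.Involutive ρ) :
      ρ.cycleType = Multiset.replicate (#ρ.support / 2) 2 := by
    have hc := Perm.cycleType_of_pow_prime_eq_one (p := 2) (hsq hρ)
    have hs := ρ.sum_cycleType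
    rw [hc, Multiset.sum_replicate, smul_eq_mul] at hs
    rw [hc]
    congr 1
    omega
  rw [Perm.isConj_iff_cycleType_eq, hct hσ, hct hτ, h]

/-- A relation that pairs up the points (possibly with themselves) is the graph of an involution. -/
theorem exists_involutive_of_existsUnique {α : Type*} {R : α → α → Prop}
    (hsymm : ∀ x y, R x y → R y x) (h : ∀ x, ∃! y, R x y) :
    ∃ σ : Equiv.Perm α, Function.Involutive σ ∧ ∀ x y, R x y ↔ σ x = y := by
  choose f hf hu using h
  have hinv : Function.Involutive f := fun x => (hu _ _ (hsymm _ _ (hf x))).symm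
  refine ⟨hinv.toPerm, hinv, fun x y => ⟨fun hxy => (hu x y hxy).symm, ?_⟩⟩
  rintro rfl
  exact hf x

namespace SimpleGraph

variable {V : Type*} {G H : SimpleGraph V}

/-- Any two 1-regular graphs on the same finite vertex set are isomorphic. -/
theorem nonempty_iso_of_existsUnique_adj [Fintype V] (hG : ∀ x, ∃! y, G.Adj x y)
    (hH : ∀ x, ∃! y, H.Adj x y) : Nonempty (G ≃g H) := by
  classical
  obtain ⟨σ, hσ, hGσ⟩ := exists_involutive_of_existsUnique (fun _ _ h => h.symm) hG
  obtain ⟨τ, hτ, hHτ⟩ := exists_involutive_of_existsUnique (fun _ _ h => h.symm) hH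
  have hsupp {K : SimpleGraph V} {ρ : Equiv.Perm V} (h : ∀ x y, K.Adj x y ↔ ρ x = y) :
      ρ.support = Finset.univ := by
    ext x
    simpa using ((h x (ρ x)).2 rfl).ne'
  obtain ⟨c, hc⟩ := isConj_iff.1 (Equiv.Perm.isConj_of_involutive hσ hτ
    (by rw [hsupp hGσ, hsupp hHτ]))
  refine ⟨⟨c, fun {x y} => ?_⟩⟩
  rw [hGσ, hHτ, ← hc]
  simp

/-- The vertices pair up as a path of length 2 centred at `v` together with isolated edges. -/
def IsPathMatching (G : SimpleGraph V) (v : V) : Prop :=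
  (G.neighborSet v).ncard = 2 ∧ ∀ u, u ≠ v → (G.neighborSet u).ncard = 1

/-- Deleting an edge at the centre of a path of length 2 leaves an involution with one fixed
point. -/
theorem IsPathMatching.exists_involutive {v : V} (hG : G.IsPathMatching v) :
    ∃ (b : V) (σ : Equiv.Perm V), Function.Involutive σ ∧ v ≠ b ∧ (∀ x, σ x = x ↔ x = b) ∧
      ∀ x y, G.Adj x y ↔ (x ≠ y ∧ σ x = y) ∨ (x = v ∧ y = b) ∨ (x = b ∧ y = v) := by
  obtain ⟨a, b, hab, hv⟩ := Set.ncard_eq_two.1 hG.1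
  have hv' : ∀ y, G.Adj v y ↔ y = a ∨ y = b := fun y => by
    rw [← mem_neighborSet, hv]; simp
  have hu : ∀ u, u ≠ v → ∃ w, ∀ y, G.Adj u y ↔ y = w := fun u h => by
    obtain ⟨w, hw⟩ := Set.ncard_eq_one.1 (hG.2 u h)
    exact ⟨w, fun y => by rw [← mem_neighborSet, hw]; simp⟩
  have hvb : G.Adj v b := by simp [hv']
  have hva : G.Adj v a := by simp [hv']
  have hb : ∀ y, G.Adj b y ↔ y = v := by
    obtain ⟨w, hw⟩ := hu b hvb.ne'
    have := (hw v).1 hvb.symm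
    rwa [← this] at hw
  obtain ⟨σ, hσ, hR⟩ := exists_involutive_of_existsUnique
    (R := fun x y => (G.Adj x y ∧ x ≠ b ∧ y ≠ b) ∨ (x = b ∧ y = b))
    (fun x y => Or.imp (fun h => ⟨h.1.symm, h.2.2, h.2.1⟩) And.symm)
    (fun x => by
      by_cases hxb : x = b
      · exact ⟨b, by simp [hxb], by simp [hxb]⟩
      by_cases hxv : x = v
      · subst hxv
        refine ⟨a, Or.inl ⟨hva, hxb, hab⟩, fun y hy => ?_⟩
        simp only [hv'] at hy
        tauto
      · obtain ⟨w, hw⟩ := hu x hxv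
        refine ⟨w, Or.inl ⟨(hw w).2 rfl, hxb, ?_⟩, fun y hy => ?_⟩
        · rintro rfl
          exact hxv ((hb x).1 ((hw w).2 rfl).symm)
        · simp only [hw] at hy
          tauto)
  refine ⟨b, σ, hσ, hvb.ne, fun x => ?_, fun x y => ?_⟩
  · rw [← hR]
    simp
  · rw [← hR]
    constructor
    · intro h
      by_cases hx : x = b
      · exact Or.inr (Or.inr ⟨hx, (hb y).1 (hx ▸ h)⟩)
      by_cases hy : y = b
      · exact Or.inr (Or.inl ⟨(hb x).1 (hy ▸ h.symm), hy⟩)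
      exact Or.inl ⟨h.ne, Or.inl ⟨h, hx, hy⟩⟩
    · rintro (⟨hne, h | h⟩ | ⟨rfl, rfl⟩ | ⟨rfl, rfl⟩)
      · exact h.1
      · exact absurd (h.1.trans h.2.symm) hne
      · exact hvb
      · exact hvb.symm

theorem IsPathMatching.nonempty_iso [Fintype V] {v w : V} (hG : G.IsPathMatching v)
    (hH : H.IsPathMatching w) : Nonempty (G ≃g H) := by
  classical
  obtain ⟨b, σ, hσ, hvb, hfixσ, hGσ⟩ := hG.exists_involutive
  obtain ⟨d, τ, hτ, hwd, hfixτ, hHτ⟩ := hH.exists_involutive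
  have hsupp {ρ : Equiv.Perm V} {z : V} (h : ∀ x, ρ x = x ↔ x = z) : ρ.support = {z}ᶜ := by
    ext x
    simp [h]
  obtain ⟨c, hc⟩ := isConj_iff.1 (Equiv.Perm.isConj_of_involutive hσ hτ
    (by rw [hsupp hfixσ, hsupp hfixτ]; simp [Finset.card_compl]))
  have hcσ : ∀ x, c (σ x) = τ (c x) := fun x => by rw [← hc]; simp
  have hcb : c b = d := by rw [← hfixτ, ← hcσ, (hfixσ b).2 rfl]
  have hcv : c v ≠ d := fun h => hvb (c.injective (h.trans hcb.symm))
  obtain ⟨e, he, hew⟩ : ∃ e : Equiv.Perm V, (∀ x, e (τ x) = τ (e x)) ∧ e (c v) = w := by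
    by_cases h1 : c v = w
    · exact ⟨1, by simp, by simpa⟩
    by_cases h2 : τ (c v) = w
    · exact ⟨τ, by simp, h2⟩
    have h3 := (hfixτ (c v)).not.2 hcv
    have h4 := (hfixτ w).not.2 hwd
    generalize c v = u at *
    refine ⟨Equiv.swap u w * Equiv.swap (τ u) (τ w), fun x => ?_, ?_⟩
    · have h5 := hτ u
      have h6 := hτ w
      have h7 := hτ x
      simp only [Equiv.Perm.mul_apply, Equiv.swap_apply_def]
      grind
    · have h5 := hτ w
      simp only [Equiv.Perm.mul_apply, Equiv.swap_apply_def]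
      grind
  set f : Equiv.Perm V := e * c with hf
  have hfσ : ∀ x, f (σ x) = τ (f x) := fun x => by simp [hf, hcσ, he]
  have hfb : f b = d := by rw [← hfixτ, ← hfσ, (hfixσ b).2 rfl]
  have hfv : f v = w := hew
  refine ⟨⟨f, fun {x y} => ?_⟩⟩
  rw [hGσ, hHτ, ← hfσ, ← hfb, ← hfv]
  simp only [f.apply_eq_iff_eq, ne_eq]

theorem Iso.ncard_neighborSet {W : Type*} {K : SimpleGraph W} (f : G ≃g K) (v : V) :
    (K.neighborSet (f v)).ncard = (G.neighborSet v).ncard := by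
  rw [← Set.ncard_image_of_injective _ f.injective]
  congr 1
  ext w
  obtain ⟨w, rfl⟩ := f.surjective w
  simp [f.map_adj_iff]

theorem ncard_neighborSet_eq_one_iff (v : V) :
    (G.neighborSet v).ncard = 1 ↔ ∃! w, G.Adj v w := by
  rw [Set.ncard_eq_one, Set.singleton_iff_unique_mem]
  rfl

end SimpleGraph

theorem deg_eq_ncard {n : ℕ} (G : SimpleGraph (Fin n)) (i : Fin n) :
    deg G i = (G.neighborSet i).ncard := by
  classical
  rw [deg, ← SimpleGraph.card_neighborSet_eq_degree, Set.ncard_eq_toFinset_card',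
    Set.toFinset_card]

theorem deg_lt {n : ℕ} (G : SimpleGraph (Fin n)) (i : Fin n) : deg G i < n := by
  classical
  simpa [deg] using G.degree_lt_card_verts i

theorem eq_top_iff_deg {n : ℕ} (G : SimpleGraph (Fin n)) : G = ⊤ ↔ ∀ i, deg G i = n - 1 := by
  classical
  have h : ∀ i, deg G i = n - 1 ↔ G.IsUniversal i := fun i => by
    simpa [deg] using G.degree_eq_card_sub_one i
  simp only [h]
  constructor
  · rintro rfl i j hij
    exact hij
  · intro h
    ext i j
    exact ⟨fun hij => hij.ne, fun hij => h i hij⟩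

theorem exists_one_lt_deg_of_odd {n : ℕ} (hn : Odd n) (G : SimpleGraph (Fin n))
    (hpos : ∀ v, 0 < deg G v) : ∃ v, 2 ≤ deg G v := by
  classical
  by_contra! h
  have h1 : ∀ v, G.degree v = 1 := fun v => by
    have h2 : deg G v = 1 := le_antisymm (Nat.le_of_lt_succ (h v)) (hpos v)
    rw [← h2, deg]
  have h4 := G.sum_degrees_eq_twice_card_edges
  simp only [h1, Finset.sum_const, Finset.card_univ, Fintype.card_fin, smul_eq_mul,
    mul_one] at h4
  exact Nat.not_even_iff_odd.2 hn ⟨_, h4.trans (two_mul _)⟩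

theorem evenMatching_existsUnique_adj {n : ℕ} (hn : Even n) (i : Fin n) :
    ∃! j, (evenMatching n).Adj i j := by
  obtain ⟨k, hk⟩ := hn
  have hi := i.2
  refine ⟨⟨if (i : ℕ) % 2 = 0 then i + 1 else i - 1, by split_ifs <;> omega⟩, ?_, ?_⟩
  · simp only [evenMatching, SimpleGraph.fromRel_adj, ne_eq, Fin.ext_iff]
    split_ifs <;> omega
  · intro j
    simp only [evenMatching, SimpleGraph.fromRel_adj, ne_eq, Fin.ext_iff]
    split_ifs <;> omega

theorem oddMatching_isPathMatching {n : ℕ} (hn : Odd n) (h3 : 3 ≤ n) :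
    (oddMatching n).IsPathMatching ⟨1, by omega⟩ := by
  obtain ⟨k, hk⟩ := hn
  refine ⟨Set.ncard_eq_two.2 ⟨⟨0, by omega⟩, ⟨2, by omega⟩, by simp, ?_⟩, fun i hi => ?_⟩
  · ext j
    simp only [oddMatching, SimpleGraph.mem_neighborSet, SimpleGraph.fromRel_adj, ne_eq,
      Fin.ext_iff, Set.mem_insert_iff, Set.mem_singleton_iff]
    omega
  · rw [SimpleGraph.ncard_neighborSet_eq_one_iff]
    have hi' := i.2
    simp only [ne_eq, Fin.ext_iff] at hi
    refine ⟨⟨if (i : ℕ) < 3 then 1 else if (i : ℕ) % 2 = 1 then i + 1 else i - 1,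
      by split_ifs <;> omega⟩, ?_, fun j => ?_⟩
    · simp only [oddMatching, SimpleGraph.fromRel_adj, ne_eq, Fin.ext_iff]
      split_ifs <;> omega
    · simp only [oddMatching, SimpleGraph.fromRel_adj, ne_eq, Fin.ext_iff]
      split_ifs <;> omega

theorem nonempty_iso_evenMatching_iff {n : ℕ} (hn : Even n) (G : SimpleGraph (Fin n)) :
    Nonempty (G ≃g evenMatching n) ↔ ∀ v, deg G v = 1 := by
  simp only [deg_eq_ncard]
  constructor
  · rintro ⟨f⟩ v
    rw [← f.ncard_neighborSet, SimpleGraph.ncard_neighborSet_eq_one_iff]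
    exact evenMatching_existsUnique_adj hn _
  · intro h
    exact SimpleGraph.nonempty_iso_of_existsUnique_adj
      (fun x => (SimpleGraph.ncard_neighborSet_eq_one_iff x).1 (h x))
      (evenMatching_existsUnique_adj hn)

theorem nonempty_iso_oddMatching_iff {n : ℕ} (hn : Odd n) (h3 : 3 ≤ n)
    (G : SimpleGraph (Fin n)) :
    Nonempty (G ≃g oddMatching n) ↔ ∃ v, deg G v = 2 ∧ ∀ u, u ≠ v → deg G u = 1 := by
  simp only [deg_eq_ncard]
  have hM := oddMatching_isPathMatching hn h3
  constructor
  · rintro ⟨f⟩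
    refine ⟨f.symm ⟨1, by omega⟩, ?_, fun u hu => ?_⟩
    · rw [f.symm.ncard_neighborSet]
      exact hM.1
    · rw [← f.ncard_neighborSet]
      exact hM.2 _ fun h => hu (by rw [← h, f.symm_apply_apply])
  · rintro ⟨v, hv⟩
    exact SimpleGraph.IsPathMatching.nonempty_iso (v := v) hv hM

open Classical in
theorem sum_ite_adj {n : ℕ} (G : SimpleGraph (Fin n)) (i : Fin n) (c : ℝ) :
    (∑ j, if G.Adj i j then c else 0) = deg G i * c := by
  rw [← Finset.sum_filter, Finset.sum_const, nsmul_eq_mul, deg,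
    ← SimpleGraph.card_neighborFinset_eq_degree, SimpleGraph.neighborFinset_eq_filter]

open Classical in
theorem sum_sum_ite_adj_inv_deg {n : ℕ} (G : SimpleGraph (Fin n)) (hpos : ∀ v, 0 < deg G v) :
    (∑ i, ∑ j, if G.Adj i j then 1 / (deg G i : ℝ) else 0) = n := by
  have h : ∀ i, (deg G i : ℝ) ≠ 0 := fun i => by exact_mod_cast (hpos i).ne'
  simp only [sum_ite_adj, mul_one_div_cancel (h _)]
  simp

open Classical in
theorem two_mul_randicM1 {n : ℕ} (G : SimpleGraph (Fin n)) :
    2 * randicM1 G =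
      ∑ i, ∑ j, if G.Adj i j then 1 / ((deg G i : ℝ) * (deg G j : ℝ)) else 0 := by
  rw [randicM1, mul_div_cancel₀ _ two_ne_zero]

open Classical in
/-- The contribution of the ordered pair `(i, j)` to `2n - 4R₋₁(G)`. -/
noncomputable def edgeDefect {n : ℕ} (G : SimpleGraph (Fin n)) (i j : Fin n) : ℝ :=
  if G.Adj i j then
    1 / (deg G i : ℝ) + 1 / (deg G j : ℝ) - 2 / ((deg G i : ℝ) * (deg G j : ℝ)) else 0

section edgeDefect

variable {n : ℕ} {G : SimpleGraph (Fin n)}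

theorem sum_sum_edgeDefect (hpos : ∀ v, 0 < deg G v) :
    ∑ i, ∑ j, edgeDefect G i j = 2 * n - 2 * (2 * randicM1 G) := by
  classical
  have h1 := sum_sum_ite_adj_inv_deg G hpos
  have h2 : (∑ i, ∑ j, if G.Adj i j then 1 / (deg G j : ℝ) else 0) = n := by
    rw [← h1, Finset.sum_comm]
    exact Finset.sum_congr rfl fun i _ => Finset.sum_congr rfl fun j _ => by rw [G.adj_comm]
  calc ∑ i, ∑ j, edgeDefect G i j
      = (∑ i, ∑ j, if G.Adj i j then 1 / (deg G i : ℝ) else 0) +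
        (∑ i, ∑ j, if G.Adj i j then 1 / (deg G j : ℝ) else 0) -
        2 * ∑ i, ∑ j, if G.Adj i j then 1 / ((deg G i : ℝ) * (deg G j : ℝ)) else 0 := by
        simp only [Finset.mul_sum, ← Finset.sum_add_distrib, ← Finset.sum_sub_distrib]
        refine Finset.sum_congr rfl fun i _ => Finset.sum_congr rfl fun j _ => ?_
        rw [edgeDefect]
        split_ifs <;> ring
    _ = 2 * n - 2 * (2 * randicM1 G) := by
        rw [two_mul_randicM1, h1, h2]
        ring

theorem edgeDefect_comm (i j : Fin n) : edgeDefect G i j = edgeDefect G j i := by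
  rw [edgeDefect, edgeDefect, G.adj_comm, mul_comm (deg G i : ℝ)]
  split_ifs <;> ring

theorem edgeDefect_of_adj (hpos : ∀ v, 0 < deg G v) {i j : Fin n} (h : G.Adj i j) :
    edgeDefect G i j =
      ((deg G i - 1 : ℝ) + (deg G j - 1)) / ((deg G i : ℝ) * deg G j) := by
  have hi : (deg G i : ℝ) ≠ 0 := by exact_mod_cast (hpos i).ne'
  have hj : (deg G j : ℝ) ≠ 0 := by exact_mod_cast (hpos j).ne'
  rw [edgeDefect, if_pos h]
  field_simp
  ring

theorem edgeDefect_nonneg (hpos : ∀ v, 0 < deg G v) (i j : Fin n) : 0 ≤ edgeDefect G i j := by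
  by_cases h : G.Adj i j
  · have hi : (1 : ℝ) ≤ deg G i := by exact_mod_cast hpos i
    have hj : (1 : ℝ) ≤ deg G j := by exact_mod_cast hpos j
    rw [edgeDefect_of_adj hpos h]
    exact div_nonneg (by linarith) (by positivity)
  · rw [edgeDefect, if_neg h]

theorem deg_eq_one_of_edgeDefect_eq_zero (hpos : ∀ v, 0 < deg G v) {i j : Fin n}
    (h : G.Adj i j) (h0 : edgeDefect G i j = 0) : deg G i = 1 := by
  have hi : (1 : ℝ) ≤ deg G i := by exact_mod_cast hpos i
  have hj : (1 : ℝ) ≤ deg G j := by exact_mod_cast hpos j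
  rw [edgeDefect_of_adj hpos h, div_eq_zero_iff] at h0
  rcases h0 with h0 | h0
  · exact_mod_cast (by linarith : (deg G i : ℝ) = 1)
  · exact absurd h0 (by positivity)

theorem exists_adj_of_deg_pos {i : Fin n} (h : 0 < deg G i) : ∃ j, G.Adj i j := by
  classical
  rw [deg, SimpleGraph.degree_pos_iff_exists_adj] at h
  exact h

theorem sum_sum_edgeDefect_nonneg (hpos : ∀ v, 0 < deg G v) :
    0 ≤ ∑ i, ∑ j, edgeDefect G i j :=
  Finset.sum_nonneg fun i _ => Finset.sum_nonneg fun j _ => edgeDefect_nonneg hpos i j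

theorem sum_sum_edgeDefect_eq_zero_iff (hpos : ∀ v, 0 < deg G v) :
    ∑ i, ∑ j, edgeDefect G i j = 0 ↔ ∀ v, deg G v = 1 := by
  constructor
  · intro h v
    obtain ⟨w, hw⟩ := exists_adj_of_deg_pos (hpos v)
    rw [Finset.sum_eq_zero_iff_of_nonneg
      fun i _ => Finset.sum_nonneg fun j _ => edgeDefect_nonneg hpos i j] at h
    have h1 := h v (Finset.mem_univ v)
    rw [Finset.sum_eq_zero_iff_of_nonneg fun j _ => edgeDefect_nonneg hpos v j] at h1
    exact deg_eq_one_of_edgeDefect_eq_zero hpos hw (h1 w (Finset.mem_univ w))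
  · intro h
    refine Finset.sum_eq_zero fun i _ => Finset.sum_eq_zero fun j _ => ?_
    rw [edgeDefect]
    norm_num [h]

/-- The total defect counts every edge at `v` twice. -/
theorem sum_sum_edgeDefect_eq (v : Fin n) :
    ∑ i, ∑ j, edgeDefect G i j = 2 * ∑ j, edgeDefect G v j +
      ∑ i ∈ Finset.univ.erase v, ∑ j ∈ Finset.univ.erase v, edgeDefect G i j := by
  have hv : edgeDefect G v v = 0 := by simp [edgeDefect]
  have h1 : ∀ i, ∑ j, edgeDefect G i j =
      edgeDefect G i v + ∑ j ∈ Finset.univ.erase v, edgeDefect G i j := fun i =>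
    (Finset.add_sum_erase _ _ (Finset.mem_univ v)).symm
  have h2 : ∑ i ∈ Finset.univ.erase v, edgeDefect G i v = ∑ j, edgeDefect G v j := by
    rw [h1 v, hv, zero_add]
    exact Finset.sum_congr rfl fun i _ => edgeDefect_comm i v
  rw [← Finset.add_sum_erase _ _ (Finset.mem_univ v)]
  simp only [h1, Finset.sum_add_distrib]
  rw [h2, h1 v]
  ring

theorem inv_deg_le_edgeDefect (hpos : ∀ v, 0 < deg G v) {v j : Fin n} (hv : 2 ≤ deg G v)
    (h : G.Adj v j) : 1 / (deg G v : ℝ) ≤ edgeDefect G v j := by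
  have hi : (2 : ℝ) ≤ deg G v := by exact_mod_cast hv
  have hj : (1 : ℝ) ≤ deg G j := by exact_mod_cast hpos j
  rw [edgeDefect_of_adj hpos h, div_le_div_iff₀ (by positivity) (by positivity)]
  nlinarith [mul_nonneg (by linarith : (0 : ℝ) ≤ deg G v) (by linarith : (0 : ℝ) ≤ deg G v - 2)]

theorem one_le_sum_edgeDefect (hpos : ∀ v, 0 < deg G v) {v : Fin n} (hv : 2 ≤ deg G v) :
    1 ≤ ∑ j, edgeDefect G v j := by
  classical
  have h0 : (deg G v : ℝ) ≠ 0 := by exact_mod_cast (hpos v).ne'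
  rw [← mul_one_div_cancel h0, ← sum_ite_adj]
  refine Finset.sum_le_sum fun j _ => ?_
  split_ifs with h
  · exact inv_deg_le_edgeDefect hpos hv h
  · exact edgeDefect_nonneg hpos v j

theorem deg_eq_two_of_sum_edgeDefect_eq_one (hpos : ∀ v, 0 < deg G v) {v : Fin n}
    (hv : 2 ≤ deg G v) (h1 : ∑ j, edgeDefect G v j = 1) : deg G v = 2 := by
  classical
  obtain ⟨w, hw⟩ := exists_adj_of_deg_pos (hpos v)
  have h0 : (deg G v : ℝ) ≠ 0 := by exact_mod_cast (hpos v).ne'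
  rw [← mul_one_div_cancel h0, ← sum_ite_adj, eq_comm, Finset.sum_eq_sum_iff_of_le] at h1
  · have h2 := h1 w (Finset.mem_univ w)
    have hi : (2 : ℝ) ≤ deg G v := by exact_mod_cast hv
    have hj : (1 : ℝ) ≤ deg G w := by exact_mod_cast hpos w
    rw [if_pos hw, edgeDefect_of_adj hpos hw, div_eq_div_iff (by positivity) (by positivity)] at h2
    have h3 : (deg G v : ℝ) * (deg G v - 2) = 0 := by linarith
    have h4 : (deg G v : ℝ) = 2 := by
      rcases mul_eq_zero.1 h3 with h | h
      · exact absurd h h0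
      · linarith
    exact_mod_cast h4
  · intro j _
    split_ifs with h
    · exact inv_deg_le_edgeDefect hpos hv h
    · exact edgeDefect_nonneg hpos v j

theorem sum_sum_erase_edgeDefect_nonneg (hpos : ∀ v, 0 < deg G v) (v : Fin n) :
    0 ≤ ∑ i ∈ Finset.univ.erase v, ∑ j ∈ Finset.univ.erase v, edgeDefect G i j :=
  Finset.sum_nonneg fun i _ => Finset.sum_nonneg fun j _ => edgeDefect_nonneg hpos i j

theorem two_le_sum_sum_edgeDefect (hpos : ∀ v, 0 < deg G v) {v : Fin n} (hv : 2 ≤ deg G v) :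
    2 ≤ ∑ i, ∑ j, edgeDefect G i j := by
  rw [sum_sum_edgeDefect_eq v]
  linarith [one_le_sum_edgeDefect hpos hv, sum_sum_erase_edgeDefect_nonneg hpos v]

theorem sum_sum_edgeDefect_eq_two_of_deg (hpos : ∀ v, 0 < deg G v) {v : Fin n}
    (hv : deg G v = 2) (hu : ∀ u, u ≠ v → deg G u = 1) :
    ∑ i, ∑ j, edgeDefect G i j = 2 := by
  classical
  rw [sum_sum_edgeDefect_eq v]
  have h1 : ∑ j, edgeDefect G v j = 1 := by
    rw [show (1 : ℝ) = deg G v * (1 / 2) by rw [hv]; norm_num, ← sum_ite_adj]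
    refine Finset.sum_congr rfl fun j _ => ?_
    split_ifs with h
    · rw [edgeDefect_of_adj hpos h, hv, hu j h.ne']
      norm_num
    · rw [edgeDefect, if_neg h]
  have h2 : ∑ i ∈ Finset.univ.erase v, ∑ j ∈ Finset.univ.erase v, edgeDefect G i j = 0 := by
    refine Finset.sum_eq_zero fun i hi => Finset.sum_eq_zero fun j hj => ?_
    rw [edgeDefect, hu i (Finset.ne_of_mem_erase hi), hu j (Finset.ne_of_mem_erase hj)]
    norm_num
  rw [h1, h2]
  norm_num

theorem deg_of_sum_sum_edgeDefect_eq_two (hpos : ∀ v, 0 < deg G v) {v : Fin n}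
    (hv : 2 ≤ deg G v) (h : ∑ i, ∑ j, edgeDefect G i j = 2) :
    deg G v = 2 ∧ ∀ u, u ≠ v → deg G u = 1 := by
  rw [sum_sum_edgeDefect_eq v] at h
  have h1 := one_le_sum_edgeDefect hpos hv
  have h2 := sum_sum_erase_edgeDefect_nonneg hpos v
  refine ⟨deg_eq_two_of_sum_edgeDefect_eq_one hpos hv (by linarith), fun u hu => ?_⟩
  have h3 : ∑ i ∈ Finset.univ.erase v, ∑ j ∈ Finset.univ.erase v, edgeDefect G i j = 0 := by
    linarith
  rw [Finset.sum_eq_zero_iff_of_nonneg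
    fun i _ => Finset.sum_nonneg fun j _ => edgeDefect_nonneg hpos i j] at h3
  have h4 := h3 u (by simpa using hu)
  rw [Finset.sum_eq_zero_iff_of_nonneg fun j _ => edgeDefect_nonneg hpos u j] at h4
  by_cases hw : ∃ w, w ≠ v ∧ G.Adj u w
  · obtain ⟨w, hwv, hw⟩ := hw
    exact deg_eq_one_of_edgeDefect_eq_zero hpos hw (h4 w (by simpa using hwv))
  · push Not at hw
    obtain ⟨x, hx⟩ := exists_adj_of_deg_pos (hpos u)
    rw [deg_eq_ncard, SimpleGraph.ncard_neighborSet_eq_one_iff]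
    have hxv : ∀ y, G.Adj u y → y = v := fun y hy => by_contra fun hyv => hw y hyv hy
    exact ⟨x, hx, fun y hy => (hxv y hy).trans (hxv x hx).symm⟩

end edgeDefect

theorem div_sub_one_le_two_mul_randicM1 {n : ℕ} (hn : 2 ≤ n) (G : SimpleGraph (Fin n))
    (hpos : ∀ v, 0 < deg G v) :
    (n : ℝ) / (n - 1) ≤ 2 * randicM1 G ∧ (2 * randicM1 G = n / (n - 1) ↔ G = ⊤) := by
  classical
  have hn' : (0 : ℝ) < n - 1 := by
    have : (2 : ℝ) ≤ n := by exact_mod_cast hn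
    linarith
  have hcast : ((n - 1 : ℕ) : ℝ) = n - 1 := by rw [Nat.cast_sub (by omega), Nat.cast_one]
  have hle : ∀ i, (deg G i : ℝ) ≤ n - 1 := fun i => by
    rw [← hcast]
    exact_mod_cast Nat.le_sub_one_of_lt (deg_lt G i)
  have hp : ∀ i, (0 : ℝ) < deg G i := fun i => by exact_mod_cast hpos i
  have hsum : (n : ℝ) / (n - 1) =
      ∑ i, ∑ j, if G.Adj i j then 1 / ((deg G i : ℝ) * (n - 1)) else 0 := by
    have h1 : ∀ i, (deg G i : ℝ) * (1 / ((deg G i : ℝ) * (n - 1))) = 1 / (n - 1) := fun i => by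
      have := (hp i).ne'
      field_simp
    simp only [sum_ite_adj, h1]
    simp [div_eq_mul_inv]
  have hterm : ∀ i j, (if G.Adj i j then 1 / ((deg G i : ℝ) * (n - 1)) else 0) ≤
      if G.Adj i j then 1 / ((deg G i : ℝ) * (deg G j : ℝ)) else 0 := fun i j => by
    split_ifs
    · exact one_div_le_one_div_of_le (mul_pos (hp i) (hp j))
        (mul_le_mul_of_nonneg_left (hle j) (hp i).le)
    · exact le_rfl
  have hrow := fun i => Finset.sum_le_sum fun j (_ : j ∈ Finset.univ) => hterm i j
  rw [two_mul_randicM1, hsum]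
  refine ⟨Finset.sum_le_sum fun i _ => hrow i, ?_⟩
  rw [eq_comm, Finset.sum_eq_sum_iff_of_le fun i _ => hrow i, eq_top_iff_deg]
  constructor
  · intro h j
    obtain ⟨i, hij⟩ := exists_adj_of_deg_pos (hpos j)
    have h1 := h i (Finset.mem_univ i)
    rw [Finset.sum_eq_sum_iff_of_le fun j _ => hterm i j] at h1
    have h2 := h1 j (Finset.mem_univ j)
    rw [if_pos hij.symm, if_pos hij.symm] at h2
    rw [one_div, one_div, inv_inj] at h2
    have h3 := mul_left_cancel₀ (hp i).ne' h2
    rw [← hcast] at h3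
    exact_mod_cast h3.symm
  · intro h i _
    simp only [h, hcast]

theorem entropyNormLap_le_iff {n : ℕ} (hn : 2 ≤ n) (G : SimpleGraph (Fin n)) (T : ℝ) :
    (1 - (n + T) / (n : ℝ) ^ 2 ≤ entropyNormLap G ↔ 2 * randicM1 G ≤ T) ∧
    (entropyNormLap G ≤ 1 - (n + T) / (n : ℝ) ^ 2 ↔ T ≤ 2 * randicM1 G) ∧
    (entropyNormLap G = 1 - (n + T) / (n : ℝ) ^ 2 ↔ 2 * randicM1 G = T) := by
  have hn' : (0 : ℝ) < (n : ℝ) ^ 2 := by positivity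
  rw [entropyNormLap, sub_le_sub_iff_left, sub_le_sub_iff_left, div_le_div_iff_of_pos_right hn',
    div_le_div_iff_of_pos_right hn', sub_right_inj, div_left_inj' hn'.ne']
  simp

/-- Corollary: for a graph on `n ≥ 2` vertices with no isolated vertices,
`1 - 2/n + 1/n² ≤ I¹_{ℒ(𝒬)}(G) ≤ 1 - 1/(n-1)` when `n` is odd and
`1 - 2/n ≤ I¹_{ℒ(𝒬)}(G) ≤ 1 - 1/(n-1)` when `n` is even; the right equality
holds iff `G` is complete, and the left equality holds iff `G` is the disjoint
union of `n/2` paths of length 1 (`n` even), resp. of `(n-3)/2` paths of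
length 1 and one path of length 2 (`n` odd). -/
theorem stmt11 {n : ℕ} (hn : 2 ≤ n) (G : SimpleGraph (Fin n))
    (hiso : ∀ v, 0 < deg G v) :
    (Odd n →
      (1 - 2 / (n : ℝ) + 1 / (n : ℝ) ^ 2 ≤ entropyNormLap G ∧
       (entropyNormLap G = 1 - 2 / (n : ℝ) + 1 / (n : ℝ) ^ 2 ↔
        Nonempty (G ≃g oddMatching n)))) ∧
    (Even n →
      (1 - 2 / (n : ℝ) ≤ entropyNormLap G ∧
       (entropyNormLap G = 1 - 2 / (n : ℝ) ↔
        Nonempty (G ≃g evenMatching n)))) ∧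
    entropyNormLap G ≤ 1 - 1 / ((n : ℝ) - 1) ∧
    (entropyNormLap G = 1 - 1 / ((n : ℝ) - 1) ↔ G = ⊤) := by
  have hn2 : (2 : ℝ) ≤ n := by exact_mod_cast hn
  have hn0 : (n : ℝ) ≠ 0 := by positivity
  have hn1 : (n : ℝ) - 1 ≠ 0 := by linarith
  have hD := sum_sum_edgeDefect hiso
  refine ⟨fun hodd => ?_, fun heven => ?_, ?_⟩
  · have h3 : 3 ≤ n := by obtain ⟨k, hk⟩ := hodd; omega
    rw [show 1 - 2 / (n : ℝ) + 1 / (n : ℝ) ^ 2 = 1 - (n + (n - 1 : ℝ)) / (n : ℝ) ^ 2 by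
      field_simp; ring, (entropyNormLap_le_iff hn G _).1, (entropyNormLap_le_iff hn G _).2.2,
      nonempty_iso_oddMatching_iff hodd h3]
    obtain ⟨v, hv⟩ := exists_one_lt_deg_of_odd hodd G hiso
    refine ⟨by linarith [two_le_sum_sum_edgeDefect hiso hv], fun h => ?_, ?_⟩
    · exact ⟨v, deg_of_sum_sum_edgeDefect_eq_two hiso hv (by linarith)⟩
    · rintro ⟨w, hw, hu⟩
      linarith [sum_sum_edgeDefect_eq_two_of_deg hiso hw hu]
  · rw [show 1 - 2 / (n : ℝ) = 1 - (n + (n : ℝ)) / (n : ℝ) ^ 2 by field_simp; ring,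
      (entropyNormLap_le_iff hn G _).1, (entropyNormLap_le_iff hn G _).2.2,
      nonempty_iso_evenMatching_iff heven, ← sum_sum_edgeDefect_eq_zero_iff hiso, hD]
    have h0 := sum_sum_edgeDefect_nonneg hiso
    exact ⟨by linarith, fun h => by linarith, fun h => by linarith⟩
  · rw [show 1 - 1 / ((n : ℝ) - 1) = 1 - (n + n / ((n : ℝ) - 1)) / (n : ℝ) ^ 2 by
      field_simp; ring, (entropyNormLap_le_iff hn G _).2.1, (entropyNormLap_le_iff hn G _).2.2]
    exact div_sub_one_le_two_mul_randicM1 hn G hiso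
end

section
/- Let T be a tree with n ≥ 2 vertices. Then I_I^1(S_n) ≤ I_I^1(T) ≤ I_I^1(P_n), where S_n and P_n denote the star and the path on n vertices, respectively, and I_I^1 denotes the generalized graph entropy of the incidence matrix. -/
open Polynomial

/-- The star on `n` vertices, with center `0`. -/
def starGraph (n : ℕ) : SimpleGraph (Fin n) :=
  SimpleGraph.fromRel (fun i _ => (i : ℕ) = 0)

open Matrix in
/-- The matrix `1 + t Q(G)`, with `Q(G)` the signless Laplacian of `G`. -/
noncomputable def shiftedLap {V : Type*} [Fintype V] [DecidableEq V] (t : ℝ)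
    (G : SimpleGraph V) : Matrix V V ℝ :=
  letI := Classical.decRel G.Adj
  1 + t • (diagonal (fun i => ∑ j, if G.Adj i j then (1 : ℝ) else 0) +
    of fun i j => if G.Adj i j then (1 : ℝ) else 0)

/-- The determinant of `1 + t Q(G)`. -/
noncomputable def lapDet {V : Type*} [Fintype V] [DecidableEq V] (t : ℝ)
    (G : SimpleGraph V) : ℝ :=
  (shiftedLap t G).det

/-- The principal minor of `1 + t Q(G)` obtained by removing the vertex `u`. -/
noncomputable def lapMinor {V : Type*} [Fintype V] [DecidableEq V] (t : ℝ)
    (G : SimpleGraph V) (u : V) : ℝ :=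
  (shiftedLap t G).adjugate u u

/-- `e` exhibits `G` as the union of `GA` and `GB` joined by the edge from `u` to `w`. -/
structure IsEdgeJoin {V A B : Type*} (e : A ⊕ B ≃ V) (G : SimpleGraph V)
    (GA : SimpleGraph A) (GB : SimpleGraph B) (u : A) (w : B) : Prop where
  adj_left : ∀ a a', G.Adj (e (.inl a)) (e (.inl a')) ↔ GA.Adj a a'
  adj_right : ∀ b b', G.Adj (e (.inr b)) (e (.inr b')) ↔ GB.Adj b b'
  adj_cross : ∀ a b, G.Adj (e (.inl a)) (e (.inr b)) ↔ a = u ∧ b = w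

namespace IsEdgeJoin

variable {V A B : Type*} [Fintype V] [DecidableEq V] [Fintype A] [DecidableEq A]
  [Fintype B] [DecidableEq B] {e : A ⊕ B ≃ V} {G : SimpleGraph V}
  {GA : SimpleGraph A} {GB : SimpleGraph B} {u : A} {w : B}

open Matrix

theorem shiftedLap_submatrix (h : IsEdgeJoin e G GA GB u w) (t : ℝ) :
    (shiftedLap t G).submatrix e e =
      fromBlocks (shiftedLap t GA + single u u t) (single u w t)
        (single w u t) (shiftedLap t GB + single w w t) := by
  classical
  have hc : ∀ a b, G.Adj (e (.inr b)) (e (.inl a)) ↔ a = u ∧ b = w := fun a b => by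
    rw [G.adj_comm, h.adj_cross]
  have hs : ∀ i, (∑ j, if G.Adj i j then (1 : ℝ) else 0) =
      (∑ a, if G.Adj i (e (.inl a)) then (1 : ℝ) else 0) +
        ∑ b, if G.Adj i (e (.inr b)) then (1 : ℝ) else 0 := fun i => by
    rw [← Equiv.sum_comp e, Fintype.sum_sum_type]
  ext (i | i) (j | j)
  · simp only [shiftedLap, submatrix_apply, Matrix.add_apply, Matrix.smul_apply, diagonal_apply, of_apply,
      fromBlocks_apply₁₁, one_apply, hs, h.adj_left, h.adj_cross, single_apply,
      EmbeddingLike.apply_eq_iff_eq, Sum.inl.injEq, smul_eq_mul]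
    by_cases hij : i = j
    · subst hij
      by_cases hu : i = u
      · subst hu; simp; ring
      · simp [hu, Ne.symm hu]
    · have : ¬ (u = i ∧ u = j) := by rintro ⟨rfl, rfl⟩; exact hij rfl
      simp [hij, this]
  · simp only [shiftedLap, submatrix_apply, Matrix.add_apply, Matrix.smul_apply, diagonal_apply, of_apply,
      fromBlocks_apply₁₂, one_apply, h.adj_cross, single_apply,
      EmbeddingLike.apply_eq_iff_eq, reduceCtorEq, smul_eq_mul, if_false, eq_comm (a := u),
      eq_comm (a := w)]
    simp
  · simp only [shiftedLap, submatrix_apply, Matrix.add_apply, Matrix.smul_apply, diagonal_apply, of_apply,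
      fromBlocks_apply₂₁, one_apply, hc, single_apply,
      EmbeddingLike.apply_eq_iff_eq, reduceCtorEq, smul_eq_mul, if_false, eq_comm (a := u),
      eq_comm (a := w), and_comm (a := i = w)]
    simp
  · simp only [shiftedLap, submatrix_apply, Matrix.add_apply, Matrix.smul_apply, diagonal_apply, of_apply,
      fromBlocks_apply₂₂, one_apply, hs, h.adj_right, hc, single_apply,
      EmbeddingLike.apply_eq_iff_eq, Sum.inr.injEq, smul_eq_mul]
    by_cases hij : i = j
    · subst hij
      by_cases hu : i = w
      · subst hu; simp; ring
      · simp [hu, Ne.symm hu]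
    · have : ¬ (w = i ∧ w = j) := by rintro ⟨rfl, rfl⟩; exact hij rfl
      simp [hij, this]

end IsEdgeJoin

namespace Matrix

theorem det_add_vecMulVec_of_isUnit {m : Type*} [Fintype m] [DecidableEq m]
    {M : Matrix m m ℝ} (hM : IsUnit M.det) (x y : m → ℝ) :
    (M + vecMulVec x y).det = M.det * (1 + y ⬝ᵥ (M⁻¹ *ᵥ x)) := by
  rw [vecMulVec_eq Unit, det_add_replicateCol_mul_replicateRow hM, det_unique (n := Unit)]
  simp [Matrix.mul_assoc, Matrix.mul_apply, dotProduct, mulVec]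

theorem det_mul_inv_apply {m : Type*} [Fintype m] [DecidableEq m]
    {M : Matrix m m ℝ} (hM : IsUnit M.det) (i j : m) :
    M.det * M⁻¹ i j = M.adjugate i j := by
  have h : M.det ≠ 0 := hM.ne_zero
  simp [inv_def, h]

theorem det_add_single {m : Type*} [Fintype m] [DecidableEq m]
    {M : Matrix m m ℝ} (hM : IsUnit M.det) (i : m) (t : ℝ) :
    (M + single i i t).det = M.det + t * M.adjugate i i := by
  have : single i i t = vecMulVec (Pi.single i t) (Pi.single i (1 : ℝ)) := by
    ext a b
    simp only [single_apply, vecMulVec_apply, Pi.single_apply, eq_comm (a := i)]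
    split_ifs <;> simp_all
  rw [this, det_add_vecMulVec_of_isUnit hM, ← det_mul_inv_apply hM]
  simp; ring

end Matrix

namespace IsEdgeJoin

variable {V A B : Type*} [Fintype V] [DecidableEq V] [Fintype A] [DecidableEq A]
  [Fintype B] [DecidableEq B] {e : A ⊕ B ≃ V} {G : SimpleGraph V}
  {GA : SimpleGraph A} {GB : SimpleGraph B} {u : A} {w : B}

open Matrix

theorem lapDet_eq (h : IsEdgeJoin e G GA GB u w) {t : ℝ}
    (hA : lapDet t GA ≠ 0) (hB : lapDet t GB ≠ 0) :
    lapDet t G = lapDet t GA * lapDet t GB + t * lapMinor t GA u * lapDet t GB +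
      t * lapDet t GA * lapMinor t GB w := by
  have hA' : IsUnit (shiftedLap t GA).det := hA.isUnit
  have hB' : IsUnit (shiftedLap t GB).det := hB.isUnit
  have hdet : (fromBlocks (shiftedLap t GA) 0 0 (shiftedLap t GB)).det =
      lapDet t GA * lapDet t GB := det_fromBlocks_zero₂₁ _ _ _
  have hblocks : fromBlocks (shiftedLap t GA + single u u t) (single u w t)
        (single w u t) (shiftedLap t GB + single w w t) =
      fromBlocks (shiftedLap t GA) 0 0 (shiftedLap t GB) +
        vecMulVec (Sum.elim (Pi.single u t) (Pi.single w t))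
          (Sum.elim (Pi.single u 1) (Pi.single w 1)) := by
    ext (i | i) (j | j) <;>
      simp only [fromBlocks_apply₁₁, fromBlocks_apply₁₂, fromBlocks_apply₂₁, fromBlocks_apply₂₂,
        Matrix.add_apply, vecMulVec_apply, single_apply, Pi.single_apply, Sum.elim_inl,
        Sum.elim_inr, eq_comm (a := u), eq_comm (a := w), Matrix.zero_apply] <;>
      split_ifs <;> simp_all
  have hunit : IsUnit (fromBlocks (shiftedLap t GA) 0 0 (shiftedLap t GB)).det := by
    rw [hdet]; exact (mul_ne_zero hA hB).isUnit
  have hinv : (fromBlocks (shiftedLap t GA) 0 0 (shiftedLap t GB))⁻¹ =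
      fromBlocks (shiftedLap t GA)⁻¹ 0 0 (shiftedLap t GB)⁻¹ := by
    rw [inv_fromBlocks_zero₂₁_of_isUnit_iff _ _ _
      (by simp only [isUnit_iff_isUnit_det, hA', hB'])]
    simp
  rw [lapDet, ← det_submatrix_equiv_self e, h.shiftedLap_submatrix, hblocks,
    det_add_vecMulVec_of_isUnit hunit, hdet, hinv, lapMinor, lapMinor,
    ← det_mul_inv_apply hA', ← det_mul_inv_apply hB', fromBlocks_mulVec]
  simp [lapDet]
  ring

theorem lapMinor_eq (h : IsEdgeJoin e G GA GB u w) {t : ℝ} (hB : lapDet t GB ≠ 0) :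
    lapMinor t G (e (.inl u)) = lapMinor t GA u * (lapDet t GB + t * lapMinor t GB w) := by
  have hB' : IsUnit (shiftedLap t GB).det := hB.isUnit
  have hsub : lapMinor t G (e (.inl u)) =
      ((shiftedLap t G).submatrix e e).adjugate (.inl u) (.inl u) := by
    rw [adjugate_submatrix_equiv_self]; rfl
  have hblocks : (fromBlocks (shiftedLap t GA + single u u t) (single u w t)
        (single w u t) (shiftedLap t GB + single w w t)).updateRow (.inl u)
          (Pi.single (.inl u) 1) =
      fromBlocks ((shiftedLap t GA).updateRow u (Pi.single u 1)) 0
        (single w u t) (shiftedLap t GB + single w w t) := by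
    ext (i | i) (j | j)
    · by_cases hi : i = u
      · simp [updateRow_apply, Pi.single_apply, hi]
      · simp [updateRow_apply, hi, Ne.symm hi]
    · by_cases hi : i = u
      · simp [updateRow_apply, hi]
      · simp [updateRow_apply, hi, Ne.symm hi]
    · simp [updateRow_apply]
    · simp [updateRow_apply]
  rw [hsub, h.shiftedLap_submatrix, adjugate_apply, hblocks, det_fromBlocks_zero₁₂,
    ← adjugate_apply, det_add_single hB']
  rfl

end IsEdgeJoin

theorem lapDet_of_subsingleton {V : Type*} [Fintype V] [DecidableEq V] [Subsingleton V]
    [Nonempty V] (t : ℝ) (G : SimpleGraph V) : lapDet t G = 1 := by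
  have := Classical.arbitrary V |> uniqueOfSubsingleton
  simp [lapDet, shiftedLap, Matrix.det_unique]

theorem lapMinor_of_subsingleton {V : Type*} [Fintype V] [DecidableEq V] [Subsingleton V] (t : ℝ)
    (G : SimpleGraph V) (u : V) : lapMinor t G u = 1 := by
  simp [lapMinor, Matrix.adjugate_subsingleton]

/-- Every tree with at least two vertices is obtained by joining two trees by an edge at a
prescribed vertex. -/
theorem SimpleGraph.IsTree.exists_isEdgeJoin {V : Type*} [Finite V] {T : SimpleGraph V}
    (hT : T.IsTree) {u w : V} (huw : T.Adj u w) :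
    ∃ (A B : Set V) (e : A ⊕ B ≃ V) (GA : SimpleGraph A) (GB : SimpleGraph B) (a : A) (b : B),
      IsEdgeJoin e T GA GB a b ∧ GA.IsTree ∧ GB.IsTree ∧ e (.inl a) = u := by
  classical
  set T' := T.deleteEdges {s(u, w)} with hT'
  have hacyc : T'.IsAcyclic := hT.isAcyclic.anti (T.deleteEdges_le _)
  have hbridge : ¬ T'.Reachable u w :=
    SimpleGraph.isBridge_iff.1 (SimpleGraph.isAcyclic_iff_forall_isBridge.1 hT.isAcyclic huw)
  have hadj : ∀ x y, T.Adj x y → T'.Adj x y ∨ (x = u ∧ y = w) ∨ (x = w ∧ y = u) := by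
    intro x y hxy
    by_cases hs : s(x, y) = s(u, w)
    · right; simpa using hs
    · left; simp [hT', SimpleGraph.deleteEdges_adj, hxy]; simpa using hs
  have hreach : ∀ x, T'.Reachable x u ∨ T'.Reachable x w := by
    intro x
    obtain ⟨p⟩ := hT.connected x u
    induction p with
    | nil => exact .inl .rfl
    | cons hxy _ ih =>
      rcases hadj _ _ hxy with h | ⟨rfl, rfl⟩ | ⟨rfl, rfl⟩
      · exact (ih huw hT' hacyc hbridge hadj).imp h.reachable.trans h.reachable.trans
      · exact .inl .rfl
      · exact .inr .rfl
  set cu := T'.connectedComponentMk u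
  set cw := T'.connectedComponentMk w
  have hcu : ∀ x, x ∈ cu.supp ↔ T'.Reachable x u := fun x => by
    simp [cu, SimpleGraph.ConnectedComponent.mem_supp_iff]
  have hcw : ∀ x, x ∈ cw.supp ↔ T'.Reachable x w := fun x => by
    simp [cw, SimpleGraph.ConnectedComponent.mem_supp_iff]
  have hdisj : ∀ x, x ∈ cu.supp → x ∈ cw.supp → False := fun x h1 h2 =>
    hbridge (((hcu x).1 h1).symm.trans ((hcw x).1 h2))
  have hbij : Function.Bijective
      (Sum.elim Subtype.val Subtype.val : cu.supp ⊕ cw.supp → V) := by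
    constructor
    · rintro (⟨x, hx⟩ | ⟨x, hx⟩) (⟨y, hy⟩ | ⟨y, hy⟩) hxy <;> simp only [Sum.elim_inl,
        Sum.elim_inr] at hxy <;> subst hxy
      · rfl
      · exact (hdisj _ hx hy).elim
      · exact (hdisj _ hy hx).elim
      · rfl
    · intro x
      rcases hreach x with h | h
      · exact ⟨.inl ⟨x, (hcu x).2 h⟩, rfl⟩
      · exact ⟨.inr ⟨x, (hcw x).2 h⟩, rfl⟩
  have huu : u ∈ cu.supp := (hcu u).2 .rfl
  have hww : w ∈ cw.supp := (hcw w).2 .rfl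
  refine ⟨cu.supp, cw.supp, Equiv.ofBijective _ hbij, cu.toSimpleGraph, cw.toSimpleGraph,
    ⟨u, huu⟩, ⟨w, hww⟩, ⟨?_, ?_, ?_⟩, hacyc.isTree_connectedComponent _,
    hacyc.isTree_connectedComponent _, rfl⟩
  · rintro ⟨x, hx⟩ ⟨y, hy⟩
    change T.Adj x y ↔ T'.Adj x y
    refine ⟨fun h => ?_, fun h => T.deleteEdges_le _ h⟩
    rcases hadj _ _ h with h | ⟨rfl, rfl⟩ | ⟨rfl, rfl⟩
    · exact h
    · exact (hdisj _ hy hww).elim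
    · exact (hdisj _ hx hww).elim
  · rintro ⟨x, hx⟩ ⟨y, hy⟩
    change T.Adj x y ↔ T'.Adj x y
    refine ⟨fun h => ?_, fun h => T.deleteEdges_le _ h⟩
    rcases hadj _ _ h with h | ⟨rfl, rfl⟩ | ⟨rfl, rfl⟩
    · exact h
    · exact (hdisj _ huu hx).elim
    · exact (hdisj _ huu hy).elim
  · rintro ⟨x, hx⟩ ⟨y, hy⟩
    change T.Adj x y ↔ _
    simp only [Subtype.mk.injEq]
    refine ⟨fun h => ?_, fun h => by rwa [h.1, h.2]⟩
    rcases hadj _ _ h with h | h | ⟨rfl, rfl⟩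
    · exact (hbridge (((hcu x).1 hx).symm.trans (h.reachable.trans ((hcw y).1 hy)))).elim
    · exact h
    · exact (hdisj _ hx hww).elim

/-- The determinant of `1 + t Q(P)` and its principal minor at an end, for the path `P` with `k`
edges. -/
noncomputable def pathPair (t : ℝ) : ℕ → ℝ × ℝ
  | 0 => (1, 1)
  | k + 1 => ((1 + t) * (pathPair t k).1 + t * (pathPair t k).2,
      (pathPair t k).1 + t * (pathPair t k).2)

section pathPair

variable {t : ℝ}

theorem pathPair_pos (ht : 0 ≤ t) (k : ℕ) : 0 < (pathPair t k).1 ∧ 0 < (pathPair t k).2 := by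
  induction k with
  | zero => simp [pathPair]
  | succ k ih =>
    obtain ⟨h1, h2⟩ := ih
    constructor <;> simp only [pathPair] <;> positivity

theorem pathPair_add_fst (a b : ℕ) :
    (pathPair t (a + b + 1)).1 = (pathPair t a).1 * (pathPair t b).1 +
      t * (pathPair t a).2 * (pathPair t b).1 + t * (pathPair t a).1 * (pathPair t b).2 := by
  induction a generalizing b with
  | zero => simp [pathPair]; ring
  | succ a ih =>
    rw [show a + 1 + b + 1 = a + (b + 1) + 1 by ring, ih]
    simp only [pathPair]
    ring

theorem pathPair_mul_snd_le (ht : 0 ≤ t) (a b : ℕ) :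
    (pathPair t a).1 * (pathPair t b).2 ≤ (pathPair t (a + b)).1 ∧
      (pathPair t a).2 * (pathPair t b).2 ≤ (pathPair t (a + b)).2 := by
  induction a with
  | zero =>
    rw [zero_add]
    refine ⟨?_, by simp [pathPair]⟩
    cases b with
    | zero => simp [pathPair]
    | succ b =>
      have := mul_nonneg ht (pathPair_pos ht b).1.le
      simp only [pathPair, one_mul]
      linarith
  | succ a ih =>
    obtain ⟨h1, h2⟩ := ih
    have h1' := mul_le_mul_of_nonneg_left h1 ht
    have h2' := mul_le_mul_of_nonneg_left h2 ht
    rw [show a + 1 + b = a + b + 1 by ring]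
    constructor <;> simp only [pathPair] <;> linarith

end pathPair

theorem SimpleGraph.IsTree.lapDet_bounds {t : ℝ} (ht : 0 ≤ t) {k : ℕ} {V : Type*} [Fintype V]
    [DecidableEq V] {T : SimpleGraph V} (hT : T.IsTree) (hk : Fintype.card V = k + 1) (u : V) :
    ((1 + t) ^ k * (1 + (k + 1) * t) ≤ (1 + t) * lapDet t T ∧ lapDet t T ≤ (pathPair t k).1) ∧
      (1 + t) ^ k ≤ lapMinor t T u ∧ lapMinor t T u ≤ (pathPair t k).2 := by
  classical
  induction k using Nat.strong_induction_on generalizing V with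
  | _ k ih =>
  rcases Nat.eq_zero_or_pos k with rfl | hpos
  · have := Fintype.card_le_one_iff_subsingleton.1 hk.le
    have : Nonempty V := ⟨u⟩
    rw [lapDet_of_subsingleton, lapMinor_of_subsingleton]
    simp [pathPair]
  have : Nontrivial V := Fintype.one_lt_card_iff_nontrivial.1 (by omega)
  obtain ⟨w, huw⟩ := hT.connected.preconnected.exists_adj_of_nontrivial u
  obtain ⟨A, B, e, GA, GB, x, y, hJ, hA, hB, rfl⟩ := hT.exists_isEdgeJoin huw
  have hcard : Fintype.card V = Fintype.card A + Fintype.card B := by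
    rw [← Fintype.card_congr e, Fintype.card_sum]
  have hA0 : 0 < Fintype.card A := Fintype.card_pos_iff.2 ⟨x⟩
  have hB0 : 0 < Fintype.card B := Fintype.card_pos_iff.2 ⟨y⟩
  obtain ⟨a, ha⟩ := Nat.exists_eq_add_of_le' hA0
  obtain ⟨b, hb⟩ := Nat.exists_eq_add_of_le' hB0
  obtain rfl : k = a + b + 1 := by omega
  obtain ⟨⟨lFA, uFA⟩, lGA, uGA⟩ := ih a (by omega) hA ha x
  obtain ⟨⟨lFB, uFB⟩, lGB, uGB⟩ := ih b (by omega) hB hb y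
  have h1t : 0 < 1 + t := by linarith
  have pA : 0 < lapDet t GA := pos_of_mul_pos_right (lt_of_lt_of_le (by positivity) lFA) h1t.le
  have pB : 0 < lapDet t GB := pos_of_mul_pos_right (lt_of_lt_of_le (by positivity) lFB) h1t.le
  have qA : 0 < lapMinor t GA x := lt_of_lt_of_le (by positivity) lGA
  have qB : 0 < lapMinor t GB y := lt_of_lt_of_le (by positivity) lGB
  obtain ⟨fa, ga⟩ := pathPair_pos ht a
  obtain ⟨fb, gb⟩ := pathPair_pos ht b
  rw [hJ.lapDet_eq pA.ne' pB.ne', hJ.lapMinor_eq pB.ne']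
  refine ⟨⟨?_, ?_⟩, ?_, ?_⟩
  · set p := (1 + t) ^ a with hp
    set q := (1 + t) ^ b with hq
    have hp0 : 0 < p := by positivity
    have hq0 : 0 < q := by positivity
    have e1 : p * (1 + (a + 1) * t) * (q * (1 + (b + 1) * t)) ≤
        (1 + t) * lapDet t GA * ((1 + t) * lapDet t GB) := by gcongr
    have e2 : p * (q * (1 + (b + 1) * t)) ≤ lapMinor t GA x * ((1 + t) * lapDet t GB) := by gcongr
    have e3 : p * (1 + (a + 1) * t) * q ≤ (1 + t) * lapDet t GA * lapMinor t GB y := by gcongr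
    have e2' := mul_le_mul_of_nonneg_left e2 (mul_nonneg ht h1t.le)
    have e3' := mul_le_mul_of_nonneg_left e3 (mul_nonneg ht h1t.le)
    refine le_of_mul_le_mul_left ?_ h1t
    have hab : 0 ≤ p * q * ((a : ℝ) * b * t ^ 2) := by positivity
    have hexp : (1 + t) ^ (a + b + 1) = p * q * (1 + t) := by rw [pow_succ, pow_add]
    rw [hexp]
    push_cast
    linarith
  · rw [pathPair_add_fst]
    gcongr
  · have e : (1 + t) ^ (b + 1) ≤ lapDet t GB + t * lapMinor t GB y := by
      refine le_of_mul_le_mul_left ?_ h1t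
      have e1 := mul_le_mul_of_nonneg_left lGB (mul_nonneg ht h1t.le)
      have : 0 ≤ (1 + t) ^ b * (b * t) := by positivity
      rw [pow_succ]
      linarith
    rw [show a + b + 1 = a + (b + 1) by ring, pow_add]
    gcongr
  · refine le_trans ?_ (pathPair_mul_snd_le ht a (b + 1)).2
    simp only [pathPair]
    gcongr

theorem pathGraph_isEdgeJoin (k : ℕ) :
    IsEdgeJoin ((Equiv.sumComm (Fin 1) (Fin (k + 1))).trans finSumFinEquiv)
      (SimpleGraph.pathGraph (k + 2)) (⊥ : SimpleGraph (Fin 1)) (SimpleGraph.pathGraph (k + 1))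
      0 (Fin.last k) := by
  refine ⟨?_, ?_, ?_⟩
  · intro a b
    obtain rfl := Subsingleton.elim a b
    exact iff_of_false (SimpleGraph.irrefl _) (SimpleGraph.irrefl _)
  · intro a b
    simp [SimpleGraph.pathGraph_adj]
  · intro a b
    have := b.isLt
    simp only [SimpleGraph.pathGraph_adj, Fin.ext_iff, Equiv.trans_apply, Equiv.sumComm_apply,
      Sum.swap_inl, Sum.swap_inr, finSumFinEquiv_apply_left, finSumFinEquiv_apply_right,
      Fin.val_natAdd, Fin.val_castAdd, Fin.val_last]
    omega

theorem starGraph_isEdgeJoin (k : ℕ) :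
    IsEdgeJoin (finSumFinEquiv (m := k + 1) (n := 1)) (starGraph (k + 2)) (starGraph (k + 1))
      (⊥ : SimpleGraph (Fin 1)) 0 0 := by
  refine ⟨?_, ?_, ?_⟩
  · intro a b
    simp only [starGraph, SimpleGraph.fromRel_adj, ne_eq, Fin.ext_iff, finSumFinEquiv_apply_left,
      Fin.val_castAdd]
  · intro a b
    obtain rfl := Subsingleton.elim a b
    exact iff_of_false (SimpleGraph.irrefl _) (SimpleGraph.irrefl _)
  · intro a b
    have := a.isLt
    simp only [starGraph, SimpleGraph.fromRel_adj, ne_eq, Fin.ext_iff, finSumFinEquiv_apply_left,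
      finSumFinEquiv_apply_right, Fin.val_natAdd, Fin.val_castAdd, Fin.val_zero]
    omega

theorem lapDet_pathGraph {t : ℝ} (ht : 0 ≤ t) (k : ℕ) :
    lapDet t (SimpleGraph.pathGraph (k + 1)) = (pathPair t k).1 ∧
      lapMinor t (SimpleGraph.pathGraph (k + 1)) (Fin.last k) = (pathPair t k).2 := by
  induction k with
  | zero =>
    exact ⟨lapDet_of_subsingleton (V := Fin 1) _ _, lapMinor_of_subsingleton (V := Fin 1) _ _ _⟩
  | succ k ih =>
    have hJ := pathGraph_isEdgeJoin k
    have h1 : lapDet t (⊥ : SimpleGraph (Fin 1)) = 1 := lapDet_of_subsingleton _ _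
    have h2 := lapMinor_of_subsingleton t (⊥ : SimpleGraph (Fin 1)) 0
    have hne : lapDet t (SimpleGraph.pathGraph (k + 1)) ≠ 0 := by
      rw [ih.1]; exact (pathPair_pos ht k).1.ne'
    have hlast : ((Equiv.sumComm (Fin 1) (Fin (k + 1))).trans finSumFinEquiv) (.inl 0) =
        Fin.last (k + 1) := rfl
    have hdet := hJ.lapDet_eq (by simp [h1]) hne
    have hmin := hJ.lapMinor_eq hne
    rw [hlast] at hmin
    rw [hdet, hmin, h1, h2, ih.1, ih.2]
    simp only [pathPair]
    constructor <;> ring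

theorem lapDet_starGraph {t : ℝ} (ht : 0 ≤ t) (k : ℕ) :
    (1 + t) * lapDet t (starGraph (k + 1)) = (1 + t) ^ k * (1 + (k + 1) * t) ∧
      lapMinor t (starGraph (k + 1)) 0 = (1 + t) ^ k := by
  have h1t : 0 < 1 + t := by linarith
  induction k with
  | zero =>
    have h1 : lapDet t (starGraph (0 + 1)) = 1 := lapDet_of_subsingleton (V := Fin 1) _ _
    exact ⟨by simp [h1], by simpa using lapMinor_of_subsingleton (V := Fin 1) _ _ _⟩
  | succ k ih =>
    have hJ := starGraph_isEdgeJoin k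
    have h1 : lapDet t (⊥ : SimpleGraph (Fin 1)) = 1 := lapDet_of_subsingleton _ _
    have h2 := lapMinor_of_subsingleton t (⊥ : SimpleGraph (Fin 1)) 0
    have hne : lapDet t (starGraph (k + 1)) ≠ 0 := by
      intro h
      have : 0 < (1 + t) ^ k * (1 + (k + 1) * t) := by positivity
      rw [← ih.1, h] at this
      simp at this
    have hzero : finSumFinEquiv (m := k + 1) (n := 1) (.inl 0) = 0 := rfl
    have hdet := hJ.lapDet_eq hne (by simp [h1])
    have hmin := hJ.lapMinor_eq (t := t) (by simp [h1])
    rw [hzero] at hmin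
    rw [hdet, hmin, h1, h2, ih.2]
    refine ⟨?_, by ring⟩
    push_cast
    linear_combination (1 + t) * ih.1

open MeasureTheory Set

/-- The kernel in the representation `√q = c⁻¹ ∫₀^∞ log (1 + t q) t^(-3/2) dt`. -/
noncomputable def sqrtKernel (q t : ℝ) : ℝ :=
  t ^ (-(3 / 2) : ℝ) * Real.log (1 + t * q)

theorem measurable_sqrtKernel (q : ℝ) : Measurable (sqrtKernel q) := by
  unfold sqrtKernel
  fun_prop

theorem integrableOn_sqrtKernel_one : IntegrableOn (sqrtKernel 1) (Ioi 0) := by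
  rw [← Ioc_union_Ioi_eq_Ioi zero_le_one]
  refine IntegrableOn.union ?_ ?_
  · have h : IntegrableOn (fun t : ℝ => t ^ (-(1 / 2) : ℝ)) (Ioc 0 1) := by
      rw [← intervalIntegrable_iff_integrableOn_Ioc_of_le zero_le_one]
      exact intervalIntegral.intervalIntegrable_rpow' (by norm_num)
    refine h.mono' (measurable_sqrtKernel 1).aestronglyMeasurable ?_
    filter_upwards [ae_restrict_mem measurableSet_Ioc] with t ht
    have ht0 : 0 < t := ht.1
    have hlog : 0 ≤ Real.log (1 + t * 1) := Real.log_nonneg (by linarith)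
    have hle : Real.log (1 + t * 1) ≤ t := by
      linarith [Real.log_le_sub_one_of_pos (show 0 < 1 + t * 1 by linarith)]
    rw [sqrtKernel, Real.norm_of_nonneg (by positivity)]
    calc t ^ (-(3 / 2) : ℝ) * Real.log (1 + t * 1) ≤ t ^ (-(3 / 2) : ℝ) * t := by gcongr
      _ = t ^ (-(1 / 2) : ℝ) := by
        rw [← Real.rpow_add_one ht0.ne']; norm_num
  · have h : IntegrableOn (fun t : ℝ => t ^ (-(5 / 4) : ℝ) * (2 ^ (1 / 4 : ℝ) * 4)) (Ioi 1) :=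
      (integrableOn_Ioi_rpow_of_lt (by norm_num) one_pos).mul_const _
    refine h.mono' (measurable_sqrtKernel 1).aestronglyMeasurable ?_
    filter_upwards [ae_restrict_mem measurableSet_Ioi] with t ht
    have ht1 : 1 < t := ht
    have ht0 : 0 < t := by linarith
    have hlog : 0 ≤ Real.log (1 + t * 1) := Real.log_nonneg (by linarith)
    have hle : Real.log (1 + t * 1) ≤ (2 * t) ^ (1 / 4 : ℝ) / (1 / 4) :=
      (Real.log_le_log (by linarith) (by linarith)).trans
        (Real.log_le_rpow_div (by linarith) (by norm_num))
    rw [sqrtKernel, Real.norm_of_nonneg (by positivity)]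
    calc t ^ (-(3 / 2) : ℝ) * Real.log (1 + t * 1)
        ≤ t ^ (-(3 / 2) : ℝ) * ((2 * t) ^ (1 / 4 : ℝ) / (1 / 4)) := by gcongr
      _ = (t ^ (-(3 / 2) : ℝ) * t ^ (1 / 4 : ℝ)) * (2 ^ (1 / 4 : ℝ) * 4) := by
        rw [Real.mul_rpow (by norm_num) ht0.le]; ring
      _ = t ^ (-(5 / 4) : ℝ) * (2 ^ (1 / 4 : ℝ) * 4) := by
        rw [← Real.rpow_add ht0]; norm_num

theorem integral_sqrtKernel_one_pos : 0 < ∫ t in Ioi 0, sqrtKernel 1 t := by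
  have hpos : ∀ t ∈ Ioi (0 : ℝ), 0 < sqrtKernel 1 t := fun t ht =>
    mul_pos (Real.rpow_pos_of_pos ht _) (Real.log_pos (by simpa using ht))
  rw [setIntegral_pos_iff_support_of_nonneg_ae _ integrableOn_sqrtKernel_one]
  · have hsub : Ioi 0 ⊆ Function.support (sqrtKernel 1) := fun t ht => (hpos t ht).ne'
    rw [inter_eq_right.2 hsub]
    simp
  · filter_upwards [ae_restrict_mem measurableSet_Ioi] with t ht using (hpos t ht).le

theorem sqrtKernel_eq_comp_mul {q t : ℝ} (hq : 0 < q) (ht : 0 < t) :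
    sqrtKernel q t = q ^ (3 / 2 : ℝ) * sqrtKernel 1 (q * t) := by
  rw [sqrtKernel, sqrtKernel, Real.mul_rpow hq.le ht.le, Real.rpow_neg hq.le]
  have : q ^ (3 / 2 : ℝ) ≠ 0 := (Real.rpow_pos_of_pos hq _).ne'
  field_simp

theorem integrableOn_sqrtKernel {q : ℝ} (hq : 0 ≤ q) : IntegrableOn (sqrtKernel q) (Ioi 0) := by
  rcases hq.eq_or_lt with rfl | hq
  · have h0 : sqrtKernel 0 = 0 := by
      ext t
      simp [sqrtKernel]
    rw [h0]
    exact integrableOn_zero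
  · refine IntegrableOn.congr_fun (f := fun t => q ^ (3 / 2 : ℝ) * sqrtKernel 1 (q * t)) ?_
      (fun t ht => (sqrtKernel_eq_comp_mul hq ht).symm) measurableSet_Ioi
    refine Integrable.const_mul ?_ _
    refine (integrableOn_Ioi_comp_mul_left_iff (sqrtKernel 1) 0 hq).2 ?_
    simpa using integrableOn_sqrtKernel_one

theorem integral_sqrtKernel {q : ℝ} (hq : 0 ≤ q) :
    ∫ t in Ioi 0, sqrtKernel q t = Real.sqrt q * ∫ t in Ioi 0, sqrtKernel 1 t := by
  rcases hq.eq_or_lt with rfl | hq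
  · simp [sqrtKernel]
  · rw [setIntegral_congr_fun measurableSet_Ioi fun t ht => sqrtKernel_eq_comp_mul hq ht,
      integral_const_mul, integral_comp_mul_left_Ioi _ _ hq, mul_zero, smul_eq_mul, ← mul_assoc,
      ← Real.rpow_neg_one, ← Real.rpow_add hq, Real.sqrt_eq_rpow]
    norm_num

theorem sum_sqrt_le_sum_sqrt_of_prod_le {ι κ : Type*} [Fintype ι] [Fintype κ] {p : ι → ℝ}
    {q : κ → ℝ} (hp : ∀ i, 0 ≤ p i) (hq : ∀ i, 0 ≤ q i)
    (h : ∀ t : ℝ, 0 < t → ∏ i, (1 + t * p i) ≤ ∏ i, (1 + t * q i)) :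
    ∑ i, Real.sqrt (p i) ≤ ∑ i, Real.sqrt (q i) := by
  refine le_of_mul_le_mul_right ?_ integral_sqrtKernel_one_pos
  simp only [Finset.sum_mul]
  rw [Finset.sum_congr rfl fun i _ => (integral_sqrtKernel (hp i)).symm,
    Finset.sum_congr rfl fun i _ => (integral_sqrtKernel (hq i)).symm,
    ← integral_finsetSum _ fun i _ => integrableOn_sqrtKernel (hp i),
    ← integral_finsetSum _ fun i _ => integrableOn_sqrtKernel (hq i)]
  refine setIntegral_mono_on (integrable_finsetSum _ fun i _ => integrableOn_sqrtKernel (hp i))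
    (integrable_finsetSum _ fun i _ => integrableOn_sqrtKernel (hq i)) measurableSet_Ioi ?_
  intro t ht
  have ht0 : 0 < t := ht
  have hp' : ∀ i, 0 < 1 + t * p i := fun i => by have := mul_nonneg ht0.le (hp i); linarith
  have hq' : ∀ i, 0 < 1 + t * q i := fun i => by have := mul_nonneg ht0.le (hq i); linarith
  simp only [sqrtKernel]
  rw [← Finset.mul_sum, ← Finset.mul_sum, ← Real.log_prod fun i _ => (hp' i).ne',
    ← Real.log_prod fun i _ => (hq' i).ne']
  refine mul_le_mul_of_nonneg_left ?_ (Real.rpow_nonneg ht0.le _)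
  exact Real.log_le_log (Finset.prod_pos fun i _ => hp' i) (h t ht0)

theorem shiftedLap_eq_signlessLap {n : ℕ} (t : ℝ) (G : SimpleGraph (Fin n)) :
    shiftedLap t G = 1 + t • signlessLap G := by
  classical
  ext i j
  simp [shiftedLap, signlessLap, deg, SimpleGraph.adjMatrix_apply, Matrix.diagonal_apply]
  congr! 3
  rw [← SimpleGraph.card_neighborFinset_eq_degree]
  congr 1
  ext k
  simp

theorem lapDet_eq_prod {n : ℕ} {t : ℝ} (ht : 0 < t) {G : SimpleGraph (Fin n)} {q : Fin n → ℝ}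
    (hq : (signlessLap G).charpoly = ∏ i, (X - C (q i))) :
    lapDet t G = ∏ i, (1 + t * q i) := by
  have hM : shiftedLap t G = (-t) • (Matrix.scalar (Fin n) (-t⁻¹) - signlessLap G) := by
    rw [shiftedLap_eq_signlessLap]
    ext i j
    by_cases hij : i = j
    · subst hij; simp; field_simp; ring
    · simp [hij]
  rw [lapDet, hM, Matrix.det_smul, ← Matrix.eval_charpoly, hq, eval_prod, Fintype.card_fin,
    ← Fin.prod_const, ← Finset.prod_mul_distrib]
  refine Finset.prod_congr rfl fun i _ => ?_
  simp
  field_simp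
  ring

/-- Corollary: for any tree `T` on `n ≥ 2` vertices,
`I¹_I(Sₙ) ≤ I¹_I(T) ≤ I¹_I(Pₙ)`, where `I¹_I(G) = 1 - 2m/IE(G)²` is the
generalized entropy of the incidence matrix (a tree has `m = n - 1` edges),
`IE(G) = ∑ √qᵢ`, and `qS`, `qT`, `qP` are the eigenvalues of the signless
Laplacians of the star `Sₙ`, of `T`, and of the path `Pₙ` respectively. -/
theorem stmt14 {n : ℕ} (hn : 2 ≤ n) (T : SimpleGraph (Fin n)) (hT : T.IsTree)
    (qS qT qP : Fin n → ℝ)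
    (hqS0 : ∀ i, 0 ≤ qS i) (hqT0 : ∀ i, 0 ≤ qT i) (hqP0 : ∀ i, 0 ≤ qP i)
    (hqS : (signlessLap (starGraph n)).charpoly = ∏ i, (X - C (qS i)))
    (hqT : (signlessLap T).charpoly = ∏ i, (X - C (qT i)))
    (hqP : (signlessLap (SimpleGraph.pathGraph n)).charpoly =
      ∏ i, (X - C (qP i))) :
    1 - 2 * ((n : ℝ) - 1) / (∑ i, Real.sqrt (qS i)) ^ 2 ≤
      1 - 2 * ((n : ℝ) - 1) / (∑ i, Real.sqrt (qT i)) ^ 2 ∧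
    1 - 2 * ((n : ℝ) - 1) / (∑ i, Real.sqrt (qT i)) ^ 2 ≤
      1 - 2 * ((n : ℝ) - 1) / (∑ i, Real.sqrt (qP i)) ^ 2 := by
  obtain ⟨k, rfl⟩ := Nat.exists_eq_add_of_le' (show 1 ≤ n by omega)
  have hbounds : ∀ t : ℝ, 0 < t →
      lapDet t (starGraph (k + 1)) ≤ lapDet t T ∧
        lapDet t T ≤ lapDet t (SimpleGraph.pathGraph (k + 1)) := by
    intro t ht
    obtain ⟨⟨hl, hu⟩, -⟩ := hT.lapDet_bounds ht.le (k := k) (by simp) 0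
    rw [← (lapDet_starGraph ht.le k).1] at hl
    exact ⟨le_of_mul_le_mul_left hl (by linarith), by rwa [(lapDet_pathGraph ht.le k).1]⟩
  have hST : ∑ i, Real.sqrt (qS i) ≤ ∑ i, Real.sqrt (qT i) :=
    sum_sqrt_le_sum_sqrt_of_prod_le hqS0 hqT0 fun t ht => by
      rw [← lapDet_eq_prod ht hqS, ← lapDet_eq_prod ht hqT]; exact (hbounds t ht).1
  have hTP : ∑ i, Real.sqrt (qT i) ≤ ∑ i, Real.sqrt (qP i) :=
    sum_sqrt_le_sum_sqrt_of_prod_le hqT0 hqP0 fun t ht => by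
      rw [← lapDet_eq_prod ht hqT, ← lapDet_eq_prod ht hqP]; exact (hbounds t ht).2
  have hS : 0 < ∑ i, Real.sqrt (qS i) := by
    refine (Finset.sum_nonneg fun i _ => Real.sqrt_nonneg _).lt_of_ne' fun h0 => ?_
    have hzero : ∀ i, qS i = 0 := fun i =>
      (Real.sqrt_eq_zero (hqS0 i)).1
        ((Finset.sum_eq_zero_iff_of_nonneg fun i _ => Real.sqrt_nonneg _).1 h0 i
          (Finset.mem_univ i))
    have h1 := lapDet_eq_prod one_pos hqS
    have h2 := (lapDet_starGraph zero_le_one k).1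
    simp only [hzero, mul_zero, add_zero, Finset.prod_const_one] at h1
    rw [h1] at h2
    have hk : (1 : ℝ) ≤ k := by exact_mod_cast (show 1 ≤ k by omega)
    have hpow : (1 : ℝ) ≤ (1 + 1) ^ k := one_le_pow₀ (by norm_num)
    nlinarith
  have hn0 : 0 ≤ 2 * (((k + 1 : ℕ) : ℝ) - 1) := by push_cast; simp
  have hT0 := hS.trans_le hST
  constructor
  · gcongr
  · gcongr
end

section
/- Let G be a finite simple graph with n ≥ 2 vertices and m edges, m ≥ 1, and let r be the number of non-isolated vertices of G. Then the generalized graph entropy of the Randić incidence matrix satisfies I_{I_R}^1(G) ≤ 1 − r/(n² − 3n + 4 + 2√(2(n−1)(n−2))), with equality if and only if G is the complete graph K_n. -/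
open Polynomial Matrix
open scoped Classical

/-- The number of non-isolated vertices of `G`. -/
noncomputable def numNonIsolated {n : ℕ} (G : SimpleGraph (Fin n)) : ℕ :=
  (Finset.univ.filter (fun v => 0 < deg G v)).card

/-- The Randić incidence matrix: rows indexed by vertices, columns by edges;
the `(i,e)` entry is `dᵢ^{-1/2}` if `i` is incident to `e`, else `0`. -/
noncomputable def randicInc {n : ℕ} (G : SimpleGraph (Fin n)) :
    Matrix (Fin n) G.edgeSet ℝ :=
  Matrix.of fun i e =>
    if i ∈ (e : Sym2 (Fin n)) then 1 / Real.sqrt (deg G i) else 0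

theorem roots_charpoly_of_eq_prod {n : ℕ} {A : Matrix (Fin n) (Fin n) ℝ} {μ : Fin n → ℝ}
    (hμ : A.charpoly = ∏ i, (X - C (μ i))) :
    A.charpoly.roots = Multiset.map μ Finset.univ.val := by
  rw [hμ, Polynomial.roots_prod]
  · simp
  · simp [Finset.prod_ne_zero_iff, Polynomial.X_sub_C_ne_zero]

theorem trace_mul_self_eq_sum_of_charpoly {n : ℕ} {A : Matrix (Fin n) (Fin n) ℝ}
    (hA : A.IsHermitian) {μ : Fin n → ℝ} (hμ : A.charpoly = ∏ i, (X - C (μ i))) :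
    (A * A).trace = ∑ i, μ i ^ 2 := by
  have h2 := roots_charpoly_of_eq_prod hμ
  have h3 : Multiset.map hA.eigenvalues Finset.univ.val = Multiset.map μ Finset.univ.val := by
    rw [← h2, hA.roots_charpoly_eq_eigenvalues]
    rfl
  have h4 : (A * A).trace = ∑ i, hA.eigenvalues i ^ 2 := by
    conv_lhs => rw [hA.spectral_theorem, ← map_mul, Unitary.conjStarAlgAut_apply,
      Matrix.trace_mul_comm, ← mul_assoc]
    simp [Matrix.trace, sq]
  rw [h4]
  have h5 := congrArg (fun s => (s.map (fun x : ℝ => x ^ 2)).sum) h3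
  simp only [Multiset.map_map] at h5
  exact h5

theorem trace_eq_sum_of_charpoly {n : ℕ} {A : Matrix (Fin n) (Fin n) ℝ}
    {μ : Fin n → ℝ} (hμ : A.charpoly = ∏ i, (X - C (μ i))) :
    A.trace = ∑ i, μ i := by
  have h2 := roots_charpoly_of_eq_prod hμ
  rw [Matrix.trace_eq_sum_roots_charpoly_of_splits, h2]
  · rfl
  · rw [hμ]
    exact Polynomial.Splits.prod fun i _ => Polynomial.Splits.X_sub_C _

theorem exists_eq_of_mulVec_eq_smul {n : ℕ} {A : Matrix (Fin n) (Fin n) ℝ}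
    {μ : Fin n → ℝ} (hμ : A.charpoly = ∏ i, (X - C (μ i))) {v : Fin n → ℝ} (hv : v ≠ 0)
    {t : ℝ} (h : A *ᵥ v = t • v) : ∃ i, μ i = t := by
  have h1 : Module.End.HasEigenvalue (Matrix.toLin' A) t :=
    Module.End.hasEigenvalue_of_hasEigenvector (x := v)
      ⟨Module.End.mem_eigenspace_iff.2 (by simpa using h), hv⟩
  have h2 : A.charpoly.IsRoot t := by
    simpa using Module.End.hasEigenvalue_iff_isRoot_charpoly _ _ |>.1 h1
  rw [hμ, Polynomial.IsRoot.def, Polynomial.eval_prod, Finset.prod_eq_zero_iff] at h2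
  obtain ⟨i, -, hi⟩ := h2
  refine ⟨i, ?_⟩
  simp at hi
  linarith

theorem card_adj_eq_deg {n : ℕ} (G : SimpleGraph (Fin n)) (i : Fin n) [DecidablePred (G.Adj i)] :
    (Finset.univ.filter (fun j => G.Adj i j)).card = deg G i := by
  unfold deg
  rw [← SimpleGraph.card_neighborFinset_eq_degree]
  congr 1
  ext j
  simp

theorem deg_pos_of_adj {n : ℕ} {G : SimpleGraph (Fin n)} {i j : Fin n} (h : G.Adj i j) :
    0 < deg G i := by
  rw [← card_adj_eq_deg, Finset.card_pos]
  exact ⟨j, by simpa using h⟩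

theorem deg_le {n : ℕ} (G : SimpleGraph (Fin n)) (i : Fin n) : deg G i ≤ n - 1 := by
  rw [← card_adj_eq_deg]
  calc _ ≤ (Finset.univ.erase i).card := Finset.card_le_card fun j hj => by
        simp only [Finset.mem_filter] at hj
        simpa using hj.2.ne'
    _ = n - 1 := by simp

theorem eq_top_of_deg {n : ℕ} {G : SimpleGraph (Fin n)} (h : ∀ i, deg G i = n - 1) : G = ⊤ := by
  ext i j
  refine ⟨fun h => h.ne, fun hij => ?_⟩
  have := (SimpleGraph.degree_eq_card_sub_one (G := G) i).1 (by
    have := h i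
    unfold deg at this
    rw [Fintype.card_fin, ← this])
  exact this hij

theorem deg_top {n : ℕ} (i : Fin n) : deg (⊤ : SimpleGraph (Fin n)) i = n - 1 := by
  rw [← card_adj_eq_deg]
  calc _ = (Finset.univ.erase i).card := by
        congr 1
        ext j
        simp [eq_comm]
    _ = n - 1 := by simp

theorem randicInc_mul_transpose_apply {n : ℕ} (G : SimpleGraph (Fin n)) (i j : Fin n) :
    (randicInc G * (randicInc G)ᵀ) i j =
      if i = j then (if 0 < deg G i then 1 else 0)
      else if G.Adj i j then 1 / (√(deg G i) * √(deg G j)) else 0 := by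
  have h1 : (randicInc G * (randicInc G)ᵀ) i j =
      (1 / √(deg G i) * (1 / √(deg G j))) * (G.incMatrix ℝ * (G.incMatrix ℝ)ᵀ) i j := by
    simp only [Matrix.mul_apply, Matrix.transpose_apply, randicInc, Matrix.of_apply,
      SimpleGraph.incMatrix_apply']
    rw [Finset.mul_sum]
    rw [← Finset.sum_subset (Finset.subset_univ G.edgeFinset)]
    · rw [← Finset.sum_subtype G.edgeFinset (p := (· ∈ G.edgeSet)) (by simp)
        (fun e => (if i ∈ e then 1 / √(deg G i) else 0) * (if j ∈ e then 1 / √(deg G j) else 0))]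
      refine Finset.sum_congr rfl fun e he => ?_
      have he' : e ∈ G.edgeSet := by simpa using he
      simp only [SimpleGraph.incidenceSet, Set.mem_ofPred_eq, he', true_and]
      split_ifs <;> simp
    · intro e _ he
      have he' : e ∉ G.edgeSet := by simpa using he
      simp [SimpleGraph.incidenceSet, he']
  rw [h1, SimpleGraph.incMatrix_mul_transpose, Matrix.of_apply]
  by_cases hij : i = j
  · subst hij
    simp only [if_true]
    have hd : G.degree i = deg G i := by
      unfold deg; congr
    rw [hd]
    split_ifs with h
    · have : (0 : ℝ) < deg G i := by exact_mod_cast h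
      rw [div_mul_div_comm, Real.mul_self_sqrt this.le]
      field_simp
    · have : deg G i = 0 := by omega
      simp [this]
  · simp only [if_neg hij]
    split_ifs
    · rw [div_mul_div_comm]; simp
    · simp

theorem isHermitian_randicInc {n : ℕ} (G : SimpleGraph (Fin n)) :
    (randicInc G * (randicInc G)ᵀ).IsHermitian := by
  rw [Matrix.IsHermitian, Matrix.conjTranspose_eq_transpose_of_trivial, Matrix.transpose_mul,
    Matrix.transpose_transpose]

theorem randicInc_mulVec_sqrt_deg {n : ℕ} (G : SimpleGraph (Fin n)) :
    (randicInc G * (randicInc G)ᵀ) *ᵥ (fun i => √(deg G i)) =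
      (2 : ℝ) • (fun i => √(deg G i)) := by
  ext i
  simp only [Matrix.mulVec, dotProduct, Pi.smul_apply, smul_eq_mul]
  have h : ∀ j, (randicInc G * (randicInc G)ᵀ) i j * √(deg G j) =
      (if i = j then √(deg G i) else 0) + (if G.Adj i j then 1 / √(deg G i) else 0) := by
    intro j
    rw [randicInc_mul_transpose_apply]
    by_cases hij : i = j
    · subst hij
      by_cases hd : 0 < deg G i
      · simp [hd]
      · have : deg G i = 0 := by omega
        simp [this]
    · by_cases ha : G.Adj i j
      · have h1 : 0 < √(deg G j : ℝ) := Real.sqrt_pos.2 (by exact_mod_cast deg_pos_of_adj ha.symm)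
        have h2 : 0 < √(deg G i : ℝ) := Real.sqrt_pos.2 (by exact_mod_cast deg_pos_of_adj ha)
        simp only [hij, ha, if_true, if_false]
        field_simp
        simp
      · simp [hij, ha]
  rw [Finset.sum_congr rfl fun j _ => h j, Finset.sum_add_distrib, Finset.sum_ite_eq,
    ← Finset.sum_filter, Finset.sum_const, card_adj_eq_deg]
  simp only [Finset.mem_univ, if_true, nsmul_eq_mul, mul_one_div, Real.div_sqrt]
  ring

theorem trace_randicInc {n : ℕ} (G : SimpleGraph (Fin n)) :
    (randicInc G * (randicInc G)ᵀ).trace = numNonIsolated G := by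
  simp [Matrix.trace, randicInc_mul_transpose_apply, numNonIsolated]

theorem trace_sq_randicInc {n : ℕ} (G : SimpleGraph (Fin n)) :
    ((randicInc G * (randicInc G)ᵀ) * (randicInc G * (randicInc G)ᵀ)).trace =
      numNonIsolated G +
        ∑ i, ∑ j, if G.Adj i j then 1 / ((deg G i : ℝ) * deg G j) else 0 := by
  rw [← trace_randicInc, Matrix.trace, Matrix.trace, ← Finset.sum_add_distrib]
  refine Finset.sum_congr rfl fun i _ => ?_
  rw [Matrix.diag_apply, Matrix.diag_apply, Matrix.mul_apply]
  have h : ∀ j, (randicInc G * (randicInc G)ᵀ) i j * (randicInc G * (randicInc G)ᵀ) j i =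
      (if i = j then (randicInc G * (randicInc G)ᵀ) i i else 0) +
      if G.Adj i j then 1 / ((deg G i : ℝ) * deg G j) else 0 := by
    intro j
    simp only [randicInc_mul_transpose_apply]
    by_cases hij : i = j
    · subst hij
      simp
    · by_cases ha : G.Adj i j
      · simp only [hij, Ne.symm hij, ha, ha.symm, if_true, if_false]
        rw [mul_comm √(deg G j : ℝ), div_mul_div_comm, mul_mul_mul_comm,
          Real.mul_self_sqrt (Nat.cast_nonneg _), Real.mul_self_sqrt (Nat.cast_nonneg _)]
        simp
      · have ha' : ¬ G.Adj j i := fun h => ha h.symm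
        simp [hij, Ne.symm hij, ha, ha']
  rw [Finset.sum_congr rfl fun j _ => h j, Finset.sum_add_distrib, Finset.sum_ite_eq]
  simp

theorem numNonIsolated_le {n : ℕ} (G : SimpleGraph (Fin n)) : numNonIsolated G ≤ n := by
  simpa [numNonIsolated] using Finset.card_filter_le Finset.univ (fun v => 0 < deg G v)

theorem deg_pos_of_numNonIsolated_eq {n : ℕ} {G : SimpleGraph (Fin n)}
    (h : numNonIsolated G = n) (i : Fin n) : 0 < deg G i := by
  have : (Finset.univ.filter (fun v => 0 < deg G v)) = Finset.univ := by
    rw [← Finset.card_eq_iff_eq_univ, Fintype.card_fin]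
    exact h
  simpa using this.ge (Finset.mem_univ i)

theorem eq_top_of_sum_inv_deg {n : ℕ} (hn : 2 ≤ n) {G : SimpleGraph (Fin n)}
    (hpos : ∀ i, 0 < deg G i)
    (h : (∑ i, ∑ j, if G.Adj i j then 1 / ((deg G i : ℝ) * deg G j) else 0) =
      n / ((n : ℝ) - 1)) : G = ⊤ := by
  have hn' : (0 : ℝ) < n - 1 := by
    have : (2 : ℝ) ≤ n := by exact_mod_cast hn
    linarith
  have hle : ∀ i, (deg G i : ℝ) ≤ n - 1 := fun i => by
    have := deg_le G i
    have h2 : deg G i + 1 ≤ n := by omega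
    have : (deg G i : ℝ) + 1 ≤ n := by exact_mod_cast h2
    linarith
  have hpos' : ∀ i, (0 : ℝ) < deg G i := fun i => by exact_mod_cast hpos i
  have hterm : ∀ i ∈ Finset.univ, ∀ j ∈ Finset.univ,
      (if G.Adj i j then 1 / ((deg G i : ℝ) * (n - 1)) else 0) ≤
      (if G.Adj i j then 1 / ((deg G i : ℝ) * deg G j) else 0) := by
    intro i _ j _
    have := hpos' i
    have := hpos' j
    split_ifs
    · gcongr
      exact hle j
    · rfl
  have hsum : (∑ i, ∑ j, if G.Adj i j then 1 / ((deg G i : ℝ) * (n - 1)) else 0) =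
      n / ((n : ℝ) - 1) := by
    have : ∀ i, (∑ j, if G.Adj i j then 1 / ((deg G i : ℝ) * (n - 1)) else 0) =
        1 / ((n : ℝ) - 1) := by
      intro i
      rw [← Finset.sum_filter, Finset.sum_const, card_adj_eq_deg, nsmul_eq_mul]
      have := hpos' i
      field_simp
    simp only [this]
    simp [div_eq_mul_inv]
  rw [← hsum, eq_comm, Finset.sum_eq_sum_iff_of_le
    (fun i hi => Finset.sum_le_sum (hterm i hi))] at h
  refine eq_top_of_deg fun j => ?_
  obtain ⟨i, hi⟩ : ∃ i, G.Adj j i := by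
    have := hpos j
    rw [← card_adj_eq_deg, Finset.card_pos] at this
    obtain ⟨i, hi⟩ := this
    exact ⟨i, by simpa using hi⟩
  have h1 := (Finset.sum_eq_sum_iff_of_le (hterm i (Finset.mem_univ i))).1
    (h i (Finset.mem_univ i)) j (Finset.mem_univ j)
  rw [if_pos hi.symm, if_pos hi.symm] at h1
  have := hpos' i
  have := hpos' j
  field_simp at h1
  have h3 : (deg G j : ℝ) + 1 = n := by linarith
  have h4 : deg G j + 1 = n := by exact_mod_cast h3
  omega

theorem sum_inv_deg_of_deg_eq {n : ℕ} (hn : 2 ≤ n) {G : SimpleGraph (Fin n)}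
    (h : ∀ i, deg G i = n - 1) :
    (∑ i, ∑ j, if G.Adj i j then 1 / ((deg G i : ℝ) * deg G j) else 0) = n / ((n : ℝ) - 1) := by
  have hn' : (0 : ℝ) < n - 1 := by
    have : (2 : ℝ) ≤ n := by exact_mod_cast hn
    linarith
  have : ∀ i, (∑ j, if G.Adj i j then 1 / ((deg G i : ℝ) * deg G j) else 0) =
      1 / ((n : ℝ) - 1) := by
    intro i
    simp only [h]
    rw [← Finset.sum_filter, Finset.sum_const, card_adj_eq_deg, nsmul_eq_mul, h,
      Nat.cast_sub (by omega), Nat.cast_one]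
    field_simp
  simp only [this]
  simp [div_eq_mul_inv]

theorem numNonIsolated_top {n : ℕ} (hn : 2 ≤ n) :
    numNonIsolated (⊤ : SimpleGraph (Fin n)) = n := by
  have : 0 < n - 1 := by omega
  simp only [numNonIsolated, deg_top, this]
  simp

theorem exists_adj_of_numEdges_pos {n : ℕ} {G : SimpleGraph (Fin n)} (h : 1 ≤ numEdges G) :
    ∃ i j, G.Adj i j := by
  unfold numEdges at h
  obtain ⟨e, he⟩ := Finset.card_pos.1 h
  rw [SimpleGraph.mem_edgeFinset] at he
  induction e with
  | _ i j => exact ⟨i, j, he⟩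

/-- Corollary: for a graph with `n ≥ 2` vertices, `m ≥ 1` edges and `r`
non-isolated vertices, with `σ₁, …, σₙ` the singular values of the Randić
incidence matrix and `I_RE(G) = ∑ σᵢ`, the generalized entropy of the Randić
incidence matrix `I¹_{I_R}(G) = 1 - r/I_RE(G)²` satisfies
`I¹_{I_R}(G) ≤ 1 - r/(n² - 3n + 4 + 2√(2(n-1)(n-2)))`, with equality iff
`G` is the complete graph `Kₙ`. -/
theorem stmt18 {n m : ℕ} (hn : 2 ≤ n) (G : SimpleGraph (Fin n)) (hm : 1 ≤ m)
    (hedge : numEdges G = m)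
    (σ : Fin n → ℝ) (hσ0 : ∀ i, 0 ≤ σ i)
    (hσ : (randicInc G * (randicInc G)ᵀ).charpoly = ∏ i, (X - C (σ i ^ 2))) :
    1 - (numNonIsolated G : ℝ) / (∑ i, σ i) ^ 2 ≤
      1 - (numNonIsolated G : ℝ) /
        ((n : ℝ) ^ 2 - 3 * (n : ℝ) + 4 +
          2 * Real.sqrt (2 * ((n : ℝ) - 1) * ((n : ℝ) - 2))) ∧
    (1 - (numNonIsolated G : ℝ) / (∑ i, σ i) ^ 2 =
      1 - (numNonIsolated G : ℝ) /
        ((n : ℝ) ^ 2 - 3 * (n : ℝ) + 4 +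
          2 * Real.sqrt (2 * ((n : ℝ) - 1) * ((n : ℝ) - 2))) ↔ G = ⊤) := by
  obtain ⟨a, b, hab⟩ := exists_adj_of_numEdges_pos (hm.trans hedge.ge)
  have hda : 0 < deg G a := deg_pos_of_adj hab
  have hr : (0 : ℝ) < numNonIsolated G := by
    have : 0 < numNonIsolated G := Finset.card_pos.2 ⟨a, by simpa using hda⟩
    exact_mod_cast this
  have hrn : (numNonIsolated G : ℝ) ≤ n := by exact_mod_cast numNonIsolated_le G
  have hn2 : (2 : ℝ) ≤ n := by exact_mod_cast hn
  obtain ⟨k, hk⟩ := exists_eq_of_mulVec_eq_smul hσ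
    (fun h => (Real.sqrt_pos.2 (by exact_mod_cast hda : (0 : ℝ) < deg G a)).ne' (congrFun h a))
    (randicInc_mulVec_sqrt_deg G)
  have htr := trace_eq_sum_of_charpoly hσ
  have htr2 := trace_mul_self_eq_sum_of_charpoly (isHermitian_randicInc G) hσ
  rw [trace_randicInc] at htr
  rw [trace_sq_randicInc] at htr2
  have hσk : σ k = √2 := by rw [← hk, Real.sqrt_sq (hσ0 k)]
  rw [← Finset.add_sum_erase _ _ (Finset.mem_univ k), hk] at htr
  rw [← Finset.add_sum_erase _ (fun i => (σ i ^ 2) ^ 2) (Finset.mem_univ k), hk] at htr2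
  have hcard : ((Finset.univ.erase k).card : ℝ) = n - 1 := by
    rw [Finset.card_erase_of_mem (Finset.mem_univ k), Finset.card_univ, Fintype.card_fin,
      Nat.cast_sub (by omega), Nat.cast_one]
  have hcs := sq_sum_le_card_mul_sum_sq (s := Finset.univ.erase k) (f := σ)
  rw [hcard] at hcs
  rw [← Finset.add_sum_erase _ σ (Finset.mem_univ k), hσk]
  set S := ∑ i ∈ Finset.univ.erase k, σ i with hS
  have hS0 : 0 ≤ S := Finset.sum_nonneg fun i _ => hσ0 i
  have hs2 : (√2 : ℝ) ^ 2 = 2 := Real.sq_sqrt (by norm_num)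
  have hs2pos : (0 : ℝ) < √2 := by positivity
  set T := √(((n : ℝ) - 1) * (n - 2)) with hT
  have hT0 : 0 ≤ T := Real.sqrt_nonneg _
  have hT2 : T ^ 2 = ((n : ℝ) - 1) * (n - 2) :=
    Real.sq_sqrt (mul_nonneg (by linarith) (by linarith))
  have hden : (n : ℝ) ^ 2 - 3 * (n : ℝ) + 4 + 2 * Real.sqrt (2 * ((n : ℝ) - 1) * ((n : ℝ) - 2)) =
      (√2 + T) ^ 2 := by
    rw [mul_assoc, Real.sqrt_mul (by norm_num), ← hT]
    linear_combination -hs2 - hT2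
  rw [hden]
  have hST : S ≤ T := by
    refine Real.le_sqrt_of_sq_le (hcs.trans ?_)
    exact mul_le_mul_of_nonneg_left (by linarith) (by linarith)
  refine ⟨?_, ?_⟩
  · gcongr
  have hiff : (1 - (numNonIsolated G : ℝ) / (√2 + S) ^ 2 =
      1 - (numNonIsolated G : ℝ) / (√2 + T) ^ 2) ↔ S = T := by
    refine ⟨fun h => ?_, fun h => by rw [h]⟩
    have h1 : (numNonIsolated G : ℝ) / (√2 + S) ^ 2 = numNonIsolated G / (√2 + T) ^ 2 := by
      linarith
    rw [div_eq_div_iff (by positivity) (by positivity)] at h1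
    have h2 := mul_left_cancel₀ hr.ne' h1
    have h3 := (sq_eq_sq₀ (by positivity) (by positivity)).1 h2
    linarith
  rw [hiff]
  have hn1 : (0 : ℝ) < n - 1 := by linarith
  set c := T / ((n : ℝ) - 1) with hc
  have hc0 : 0 ≤ c := by positivity
  have hcT : (n - 1) * c = T := by rw [hc]; field_simp
  have hc2 : (n - 1) * c ^ 2 = n - 2 := by
    rw [hc, div_pow, hT2]; field_simp
  constructor
  · intro hEq
    have hdev : ∑ i ∈ Finset.univ.erase k, (σ i - c) ^ 2 = numNonIsolated G - n := by
      simp only [sub_sq, Finset.sum_add_distrib, Finset.sum_sub_distrib, Finset.sum_const,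
        nsmul_eq_mul, hcard, ← Finset.sum_mul, ← Finset.mul_sum]
      rw [← hS, hEq]
      linear_combination -htr - hc2 + 2 * c * hcT
    have hdev0 : 0 ≤ ∑ i ∈ Finset.univ.erase k, (σ i - c) ^ 2 :=
      Finset.sum_nonneg fun i _ => sq_nonneg _
    have hrn' : (numNonIsolated G : ℝ) = n := by linarith
    rw [hrn', sub_self, Finset.sum_eq_zero_iff_of_nonneg fun i _ => sq_nonneg _] at hdev
    have hσc : ∀ i ∈ Finset.univ.erase k, (σ i ^ 2) ^ 2 = (c ^ 2) ^ 2 := fun i hi => by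
      have := pow_eq_zero_iff (two_ne_zero) |>.1 (hdev i hi)
      rw [sub_eq_zero.1 this]
    rw [Finset.sum_congr rfl hσc, Finset.sum_const, nsmul_eq_mul, hcard, hrn'] at htr2
    refine eq_top_of_sum_inv_deg hn
      (deg_pos_of_numNonIsolated_eq (by exact_mod_cast hrn')) ?_
    rw [eq_div_iff hn1.ne']
    linear_combination (n - 1) * htr2 + ((n - 1) * c ^ 2 + (n - 2)) * hc2
  · intro hG
    have hGr : numNonIsolated G = n := hG ▸ numNonIsolated_top hn
    rw [sum_inv_deg_of_deg_eq hn fun i => hG ▸ deg_top i, hGr] at htr2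
    rw [hGr] at htr
    have hn4 : ((n : ℝ) - 1) * (n / (n - 1)) = n := by field_simp
    have hdev : (n - 1) * ∑ i ∈ Finset.univ.erase k, (σ i ^ 2 - c ^ 2) ^ 2 = 0 := by
      simp only [sub_sq, Finset.sum_add_distrib, Finset.sum_sub_distrib, Finset.sum_const,
        nsmul_eq_mul, hcard, ← Finset.sum_mul, ← Finset.mul_sum]
      linear_combination -(n - 1) * htr2 + hn4 + 2 * (n - 1) * c ^ 2 * htr +
        ((n - 1) * c ^ 2 - (n - 2)) * hc2
    have hdev' := (mul_eq_zero.1 hdev).resolve_left hn1.ne'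
    rw [Finset.sum_eq_zero_iff_of_nonneg fun i _ => sq_nonneg _] at hdev'
    have hσc : ∀ i ∈ Finset.univ.erase k, σ i = c := fun i hi => by
      have := pow_eq_zero_iff (two_ne_zero) |>.1 (hdev' i hi)
      exact (sq_eq_sq₀ (hσ0 i) hc0).1 (sub_eq_zero.1 this)
    rw [hS, Finset.sum_congr rfl hσc, Finset.sum_const, nsmul_eq_mul, hcard, hcT]
end
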